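/- arXiv:2301.00441 — 4 statements merged into one kernel-verified Lean document; each statement's English description precedes it below -/
import Mathlib

section
/- For every ε > 0 there exists a constant C(ε) > 0 with the following property: for every positive integer p, every α ∈ (0,1], and all reals X₂ > X₁ ≥ 0, both of the counting functions #{ q ∈ ℕ : X₁ ≤ q ≤ X₂, gcd(q,p) = 1, inv_p(q) ≤ α·p } and #{ q ∈ ℕ : X₁ ≤ q ≤ X₂, gcd(q,p) = 1, inv_p(q) > (1−α)·p } differ from α·(φ(p)/p)·(X₂ − X₁) by at most C(ε)·(X₂ − X₁ + p)/p^{1/2−ε}, where φ is Euler's totient function. -/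
/-- `inv_p(q)`: the least positive integer in the residue class `q⁻¹ (mod p)`. -/
def modInv (p q : ℕ) : ℕ := if ((q : ZMod p)⁻¹).val = 0 then p else ((q : ZMod p)⁻¹).val


section partA1

open Polynomial

lemma step_indep {F : Type*} [Field F] (B s : ℕ → F[X]) (d0 R : ℕ) 
    (hB : ∀ i, (B i).natDegree = d0 + i * R) (hB0 : ∀ i, B i ≠ 0)
    (hs : ∀ i, s i ∈ degreeLT F R) :
    ∀ N, ∑ i ∈ Finset.range N, s i * B i = 0 → ∀ i < N, s i = 0 := by
  intro N
  induction N with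
  | zero => intro _ i hi; omega
  | succ N ih =>
    intro h
    rw [Finset.sum_range_succ] at h
    have hsN : s N = 0 := by
      by_contra hne
      have h1 : ∑ i ∈ Finset.range N, s i * B i ∈ degreeLT F (d0 + N * R) := by
        refine Submodule.sum_mem _ fun i hi => ?_
        have hi' := Finset.mem_range.1 hi
        rw [mem_degreeLT]
        by_cases h0 : s i = 0
        · rw [h0, zero_mul, degree_zero]; exact WithBot.bot_lt_coe _
        have h2 := mem_degreeLT.1 (hs i)
        rw [degree_eq_natDegree h0] at h2
        have h3 : (s i).natDegree < R := by exact_mod_cast h2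
        rw [degree_eq_natDegree (mul_ne_zero h0 (hB0 i)), natDegree_mul h0 (hB0 i), hB]
        have : (i + 1) * R ≤ N * R := Nat.mul_le_mul_right _ hi'
        have h5 : (i + 1) * R = i * R + R := by ring
        have h4 : (s i).natDegree + (d0 + i * R) < d0 + N * R := by omega
        exact_mod_cast h4
      have h2 : s N * B N = - ∑ i ∈ Finset.range N, s i * B i := by linear_combination h
      rw [← Submodule.neg_mem_iff, ← h2, mem_degreeLT,
        degree_eq_natDegree (mul_ne_zero hne (hB0 N)), natDegree_mul hne (hB0 N), hB] at h1
      have h3 : (s N).natDegree + (d0 + N * R) < d0 + N * R := by exact_mod_cast h1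
      omega
    intro i hi
    rcases Nat.lt_succ_iff_lt_or_eq.1 hi with h' | h'
    · apply ih _ i h'
      simpa [hsN] using h
    · rw [h', hsN]

lemma step_kernel {F : Type*} [Field F] {ι : Type*} [Fintype ι] (H : ι → F[X]) (E : ℕ)
    (hH : ∀ i, H i ∈ degreeLT F E) (hE : E < Fintype.card ι) :
    ∃ t : ι → F, t ≠ 0 ∧ ∑ i, C (t i) * H i = 0 := by
  let f : (ι → F) →ₗ[F] (degreeLT F E) :=
    ∑ i, (LinearMap.proj i : (ι → F) →ₗ[F] F).smulRight (⟨H i, hH i⟩ : degreeLT F E)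
  have hfd : Module.finrank F (degreeLT F E) = E := by
    rw [(degreeLTEquiv F E).finrank_eq]; simp
  have : FiniteDimensional F (degreeLT F E) := Module.Finite.equiv (degreeLTEquiv F E).symm
  have := LinearMap.ker_ne_bot_of_finrank_lt (f := f) (by rw [hfd]; simpa using hE)
  obtain ⟨t, ht, ht0⟩ := Submodule.exists_mem_ne_zero_of_ne_bot this
  refine ⟨t, ht0, ?_⟩
  have h1 : f t = 0 := ht
  have h2 : ((f t : degreeLT F E) : F[X]) = 0 := by rw [h1]; rfl
  rw [← h2]
  simp [f, smul_eq_C_mul]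

/-- Stepanov's bound. -/
theorem stepanov {F : Type*} [Field F] [Fintype F] [DecidableEq F] (p m : ℕ) [hp : Fact p.Prime]
    [CharP F p] (hm : 3 ≤ m) (hF : Fintype.card F = p ^ (2 * m)) (a b c : F) (ha : a ^ p = a)
    (hb : b ^ p = b) (ha0 : a ≠ 0) :
    (Finset.univ.filter (fun x : F => x ≠ 0 ∧
      ∑ i ∈ Finset.range (2 * m), (a * x + b * x⁻¹) ^ p ^ i = c)).card
      ≤ p ^ (2 * m - 1) + 3 * p ^ m := by
  have hp2 := hp.out.two_le
  obtain ⟨m', rfl⟩ : ∃ m', m = m' + 1 := ⟨m - 1, by omega⟩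
  set R := p ^ m' with hRdef
  set M := p ^ (m' + 1) with hMdef
  have hMR : M = p * R := by rw [hMdef, hRdef, pow_succ]; ring
  have hR4 : 4 ≤ R := by
    calc 4 = 2 ^ 2 := by norm_num
      _ ≤ p ^ 2 := Nat.pow_le_pow_left hp2 2
      _ ≤ p ^ m' := Nat.pow_le_pow_right (by omega) (by omega)
  have hapow : ∀ i, a ^ p ^ i = a := by
    intro i; induction i with
    | zero => simp
    | succ i ih => rw [pow_succ, pow_mul, ih, ha]
  have hbpow : ∀ i, b ^ p ^ i = b := by
    intro i; induction i with
    | zero => simp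
    | succ i ih => rw [pow_succ, pow_mul, ih, hb]
  have hple : ∀ i ∈ Finset.range (m' + 1), p ^ i ≤ R := fun i hi =>
    Nat.pow_le_pow_right (by omega) (by have := Finset.mem_range.1 hi; omega)
  -- the polynomial U
  let U : F[X] := ∑ i ∈ Finset.range (m' + 1), (C a * X ^ (R + p ^ i) + C b * X ^ (R - p ^ i))
  have hUle : U.natDegree ≤ 2 * R := by
    refine natDegree_sum_le_of_forall_le _ _ fun i hi => ?_
    have := hple i hi
    refine (natDegree_add_le _ _).trans (max_le ?_ ?_)
    · exact (natDegree_C_mul_X_pow_le _ _).trans (by omega)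
    · exact (natDegree_C_mul_X_pow_le _ _).trans (by omega)
  have hUcoeff : U.coeff (2 * R) = a := by
    simp only [U, finsetSum_coeff, coeff_add, coeff_C_mul, coeff_X_pow]
    rw [Finset.sum_range_succ, Finset.sum_eq_zero]
    · have h1 : 2 * R = R + p ^ m' := by omega
      have h2 : ¬ (2 * R = R - p ^ m') := by omega
      rw [if_pos h1, if_neg h2]; simp
    · intro i hi
      have : p ^ i < R := Nat.pow_lt_pow_right (by omega) (Finset.mem_range.1 hi)
      rw [if_neg (by omega), if_neg (by omega)]; simp
  have hUdeg : U.natDegree = 2 * R :=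
    le_antisymm hUle (le_natDegree_of_ne_zero (by rw [hUcoeff]; exact ha0))
  have hU0 : U ≠ 0 := by
    intro h; rw [h] at hUcoeff; exact ha0 (by simpa using hUcoeff.symm)
  let t : F → F := fun x => ∑ i ∈ Finset.range (m' + 1), (a * x + b * x⁻¹) ^ p ^ i
  have hUeval : ∀ x : F, x ≠ 0 → U.eval x = x ^ R * t x := by
    intro x hx
    simp only [U, t, eval_finsetSum, Finset.mul_sum]
    refine Finset.sum_congr rfl fun i hi => ?_
    have hle := hple i hi
    rw [add_pow_char_pow, mul_pow, mul_pow, hapow, hbpow]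
    simp only [eval_add, eval_mul, eval_C, eval_pow, eval_X]
    have : x ^ (R - p ^ i) = x ^ R * (x⁻¹) ^ p ^ i := by
      rw [inv_pow, ← div_eq_mul_inv, eq_div_iff (pow_ne_zero _ hx), ← pow_add]
      congr 1; omega
    rw [this, pow_add]; ring
  have ht : ∀ x : F, ∑ i ∈ Finset.range (2 * (m' + 1)), (a * x + b * x⁻¹) ^ p ^ i
      = t x + (t x) ^ M := by
    intro x
    have : ExpChar F p := ExpChar.prime hp.out
    rw [two_mul, Finset.sum_range_add, hMdef, sum_pow_char_pow]
    congr 1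
    refine Finset.sum_congr rfl fun i _ => ?_
    rw [← pow_mul, ← pow_add, add_comm (m' + 1) i]
  set K := R + 2 with hK
  let B : ℕ → F[X] := fun i => U ^ (i % p) * X ^ ((p - 1 - i % p) * R) * X ^ (M * (i / p))
  let G : ℕ → F[X] := fun i =>
    (C c * X ^ R - U) ^ (i % p) * X ^ ((p - 1 - i % p) * R) * X ^ (i / p)
  have hBdeg : ∀ i, (B i).natDegree = (p - 1) * R + i * R := by
    intro i
    have hlt := Nat.mod_lt i hp.out.pos
    simp only [B]
    rw [natDegree_mul (mul_ne_zero (pow_ne_zero _ hU0) (pow_ne_zero _ X_ne_zero))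
      (pow_ne_zero _ X_ne_zero), natDegree_mul (pow_ne_zero _ hU0) (pow_ne_zero _ X_ne_zero),
      natDegree_pow, natDegree_X_pow, natDegree_X_pow, hUdeg, hMR]
    have e := Nat.div_add_mod i p
    obtain ⟨z, hz⟩ : ∃ z, p - 1 = i % p + z := ⟨p - 1 - i % p, by omega⟩
    rw [hz, Nat.add_sub_cancel_left]
    have e2 : i * R = (p * (i / p) + i % p) * R := by rw [e]
    rw [e2]
    ring
  have hB0 : ∀ i, B i ≠ 0 := fun i =>
    mul_ne_zero (mul_ne_zero (pow_ne_zero _ hU0) (pow_ne_zero _ X_ne_zero))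
      (pow_ne_zero _ X_ne_zero)
  have hGdeg : ∀ i < p * K, (G i).natDegree ≤ 2 * (p - 1) * R + (K - 1) := by
    intro i hi
    have hlt := Nat.mod_lt i hp.out.pos
    have hdiv : i / p < K := Nat.div_lt_of_lt_mul hi
    have h1 : (C c * X ^ R - U).natDegree ≤ 2 * R := by
      refine (natDegree_sub_le _ _).trans (max_le ?_ hUle)
      exact (natDegree_C_mul_X_pow_le _ _).trans (by omega)
    have h2 : ((C c * X ^ R - U) ^ (i % p)).natDegree ≤ (i % p) * (2 * R) :=
      natDegree_pow_le_of_le _ h1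
    refine (natDegree_mul_le).trans ?_
    rw [natDegree_X_pow]
    have h3 := natDegree_mul_le (p := (C c * X ^ R - U) ^ (i % p))
      (q := X ^ ((p - 1 - i % p) * R))
    rw [natDegree_X_pow] at h3
    obtain ⟨z, hz⟩ : ∃ z, p - 1 = i % p + z := ⟨p - 1 - i % p, by omega⟩
    rw [hz, Nat.add_sub_cancel_left] at h3 ⊢
    have : 2 * (i % p + z) * R = i % p * (2 * R) + z * R + z * R := by ring
    have : 0 ≤ z * R := Nat.zero_le _
    omega
  set E := (R - 1) * M + 2 * (p - 1) * R + K with hE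
  obtain ⟨τ, hτ0, hτ⟩ := step_kernel (ι := Fin (p * K) × Fin R)
    (fun ie => X ^ ((ie.2 : ℕ) * M) * G ie.1) E
    (by
      rintro ⟨i, e⟩
      have hg := hGdeg i i.2
      have he : (e : ℕ) * M ≤ (R - 1) * M := Nat.mul_le_mul_right _ (by have := e.2; omega)
      rw [mem_degreeLT]
      refine lt_of_le_of_lt degree_le_natDegree ?_
      have h3 := natDegree_mul_le (p := (X : F[X]) ^ ((e : ℕ) * M)) (q := G i)
      rw [natDegree_X_pow] at h3
      have : (X ^ ((e : ℕ) * M) * G i).natDegree < E := by omega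
      exact_mod_cast this)
    (by
      simp only [Fintype.card_prod, Fintype.card_fin]
      have h1 : p * K * R = K * M := by rw [hMR]; ring
      rw [h1, hE, hK]
      obtain ⟨r, hr⟩ : ∃ r, R = r + 1 := ⟨R - 1, by omega⟩
      obtain ⟨z, hz⟩ : ∃ z, p = z + 2 := ⟨p - 2, by omega⟩
      have h2 : 2 * (p - 1) * R + 2 * R = 2 * M := by
        rw [hMR, hz, show z + 2 - 1 = z + 1 by omega]; ring
      have h3 : (R + 2) * M = (R - 1) * M + 3 * M := by
        rw [hr, Nat.add_sub_cancel]; ring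
      have h4 : 2 * R ≤ M := by rw [hMR]; exact Nat.mul_le_mul_right _ hp2
      omega)
  -- choose M-th roots
  have hroot : ∀ z : F, ∃ w : F, w ^ M = z := by
    intro z
    refine ⟨z ^ M, ?_⟩
    rw [← pow_mul, hMdef, ← pow_add, ← two_mul, ← hF, FiniteField.pow_card]
  choose rt hrt using hroot
  let s : ℕ → F[X] := fun i => if h : i < p * K then
    ∑ e : Fin R, C (rt (τ (⟨i, h⟩, e))) * X ^ (e : ℕ) else 0
  have hs : ∀ i, s i ∈ degreeLT F R := by
    intro i
    by_cases h : i < p * K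
    · simp only [s, dif_pos h]
      refine Submodule.sum_mem _ fun e _ => ?_
      rw [mem_degreeLT]
      refine lt_of_le_of_lt (degree_C_mul_X_pow_le _ _) ?_
      exact_mod_cast e.2
    · simp only [s, dif_neg h]; exact Submodule.zero_mem _
  let Ψ : F[X] := ∑ i ∈ Finset.range (p * K), s i * B i
  have hΨ0 : Ψ ≠ 0 := by
    intro h
    have h1 := step_indep B s _ R hBdeg hB0 hs _ h
    apply hτ0
    funext ⟨i, e⟩
    have h2 := h1 i i.2
    simp only [s, dif_pos i.2] at h2
    have h3 := congrArg (fun q => coeff q (e : ℕ)) h2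
    simp only [finsetSum_coeff, coeff_C_mul, coeff_X_pow, coeff_zero] at h3
    rw [Finset.sum_eq_single e] at h3
    · simp only [if_true, mul_one] at h3
      have := hrt (τ (i, e))
      rw [h3, zero_pow (by positivity)] at this
      simpa using this.symm
    · intro e' _ hne
      rw [if_neg (fun h => hne (Fin.ext h.symm)), mul_zero]
    · simp
  have hΨdeg : Ψ.natDegree ≤ p ^ (2 * (m' + 1) - 1) + 3 * M := by
    have : Ψ.natDegree ≤ (p - 1) * R + (p * K) * R := by
      refine natDegree_sum_le_of_forall_le _ _ fun i hi => ?_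
      have hi' := Finset.mem_range.1 hi
      by_cases h0 : s i = 0
      · simp [h0]
      have h2 := mem_degreeLT.1 (hs i)
      rw [degree_eq_natDegree h0] at h2
      have h3 : (s i).natDegree < R := by exact_mod_cast h2
      rw [natDegree_mul h0 (hB0 i), hBdeg]
      have : (i + 1) * R ≤ (p * K) * R := Nat.mul_le_mul_right _ hi'
      have h5 : (i + 1) * R = i * R + R := by ring
      omega
    have h1 : p ^ (2 * (m' + 1) - 1) = M * R := by
      rw [hMdef, hRdef, ← pow_add]; congr 1; omega
    have h2 : p * K * R = M * R + 2 * M := by rw [hMR, hK]; ring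
    have h3 : (p - 1) * R ≤ M := by rw [hMR]; exact Nat.mul_le_mul_right _ (by omega)
    omega
  refine le_trans ?_ hΨdeg
  refine le_trans ?_ (card_roots' Ψ)
  refine le_trans ?_ (Multiset.toFinset_card_le _)
  refine Finset.card_le_card fun x hx => ?_
  simp only [Finset.mem_filter, Finset.mem_univ, true_and] at hx
  obtain ⟨hx0, hx1⟩ := hx
  rw [ht] at hx1
  rw [Multiset.mem_toFinset, mem_roots hΨ0, IsRoot.def]
  have hxq : x ^ (M * M) = x := by
    rw [hMdef, ← pow_add, ← two_mul, ← hF, FiniteField.pow_card]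
  have key : (Ψ.eval x) ^ M = 0 := by
    have : ExpChar F p := ExpChar.prime hp.out
    have e0 := congrArg (eval x) hτ
    simp only [eval_finsetSum, Fintype.sum_prod_type, eval_zero] at e0
    simp only [Ψ, eval_finsetSum]
    rw [hMdef, sum_pow_char_pow, ← hMdef, Finset.sum_range]
    have hterm : ∀ i : Fin (p * K), (eval x (s i * B i)) ^ M * x ^ ((p - 1) * R) =
        x ^ ((p - 1) * R * M) *
        ∑ e : Fin R, eval x (C (τ (i, e)) * (X ^ ((e : ℕ) * M) * G i)) := by
      intro i
      have hlt := Nat.mod_lt (i : ℕ) hp.out.pos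
      have h1 : (eval x (s i)) ^ M = ∑ e : Fin R, τ (i, e) * x ^ ((e : ℕ) * M) := by
        simp only [s, dif_pos i.2, eval_finsetSum]
        rw [hMdef, sum_pow_char_pow, ← hMdef]
        refine Finset.sum_congr rfl fun e _ => ?_
        simp only [eval_mul, eval_C, eval_pow, eval_X]
        rw [mul_pow, hrt, ← pow_mul]
      have h2 : (eval x (B i)) ^ M * x ^ ((p - 1) * R)
          = x ^ ((p - 1) * R * M) * eval x (G i) := by
        simp only [B, G, eval_mul, eval_pow, eval_X, eval_sub, eval_C]
        rw [hUeval x hx0]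
        have h3 : c * x ^ R - x ^ R * t x = x ^ R * (t x) ^ M := by rw [← hx1]; ring
        rw [h3]
        obtain ⟨z, hz⟩ : ∃ z, p - 1 = (i : ℕ) % p + z := ⟨p - 1 - i % p, by omega⟩
        rw [hz, Nat.add_sub_cancel_left]
        have h4 : (x ^ (M * ((i : ℕ) / p))) ^ M = x ^ ((i : ℕ) / p) := by
          rw [← pow_mul, show M * ((i : ℕ) / p) * M = M * M * ((i : ℕ) / p) by ring, pow_mul, hxq]
        rw [mul_pow, mul_pow, h4]
        ring
      rw [eval_mul, mul_pow, mul_assoc, h2, h1]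
      simp only [eval_mul, eval_C, eval_pow, eval_X]
      rw [Finset.sum_mul, Finset.mul_sum]
      refine Finset.sum_congr rfl fun e _ => ?_
      ring
    have h5 : (∑ i : Fin (p * K), (eval x (s i * B i)) ^ M) * x ^ ((p - 1) * R) = 0 := by
      rw [Finset.sum_mul, Finset.sum_congr rfl (fun i _ => hterm i), ← Finset.mul_sum, e0, mul_zero]
    exact (mul_eq_zero.1 h5).resolve_right (pow_ne_zero _ hx0)
  exact pow_eq_zero_iff (by positivity) |>.1 key

end partA1

section partA2

open Polynomial

lemma adjoin_inv_eq {k L : Type*} [Field k] [Field L] [Algebra k L] (x : L) :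
    IntermediateField.adjoin k {x⁻¹} = IntermediateField.adjoin k {x} := by
  apply le_antisymm
  · rw [IntermediateField.adjoin_simple_le_iff]
    exact inv_mem (IntermediateField.mem_adjoin_simple_self k x)
  · rw [IntermediateField.adjoin_simple_le_iff]
    have := inv_mem (IntermediateField.mem_adjoin_simple_self k x⁻¹)
    rwa [inv_inv] at this

lemma nextCoeff_minpoly_inv {k L : Type*} [Field k] [Field L] [Algebra k L] [FiniteDimensional k L]
    (x : L) (hx : x ≠ 0) :
    (minpoly k x⁻¹).nextCoeff = (minpoly k x).coeff 1 / (minpoly k x).coeff 0 := by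
  have hi : IsIntegral k x := IsIntegral.of_finite k x
  have hi' : IsIntegral k x⁻¹ := IsIntegral.of_finite k x⁻¹
  set P := minpoly k x with hP
  have hP0 : P.coeff 0 ≠ 0 := fun h => hx ((minpoly.coeff_zero_eq_zero hi).1 h)
  have hPm : P.Monic := minpoly.monic hi
  have hdeg : (minpoly k x⁻¹).natDegree = P.natDegree := by
    rw [← IntermediateField.adjoin.finrank hi', hP, ← IntermediateField.adjoin.finrank hi,
      adjoin_inv_eq]
  have hpos : 0 < P.natDegree := minpoly.natDegree_pos hi
  set Q := C (P.coeff 0)⁻¹ * P.reverse with hQ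
  have hPr : P.reverse.natDegree = P.natDegree := by
    rw [reverse_natDegree, natTrailingDegree_eq_zero.2 (Or.inr hP0), Nat.sub_zero]
  have hQdeg : Q.natDegree = P.natDegree := by
    rw [hQ, natDegree_C_mul (inv_ne_zero hP0), hPr]
  have hQm : Q.Monic := by
    rw [Monic, leadingCoeff, hQdeg, hQ, coeff_C_mul, coeff_reverse, revAt_le le_rfl, Nat.sub_self,
      inv_mul_cancel₀ hP0]
  have hQ0 : aeval x⁻¹ Q = 0 := by
    rw [hQ, map_mul]
    have : aeval x⁻¹ P.reverse = 0 := by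
      let _ := invertibleOfNonzero hx
      have h := (eval₂_reverse_eq_zero_iff (algebraMap k L) x P).2 (minpoly.aeval k x)
      rwa [invOf_eq_inv] at h
    rw [this, mul_zero]
  have : Q = minpoly k x⁻¹ := eq_of_monic_of_dvd_of_natDegree_le (minpoly.monic hi') hQm
    (minpoly.dvd k _ hQ0) (by rw [hdeg, hQdeg])
  rw [← this, nextCoeff_of_natDegree_pos (by omega), hQdeg, hQ, coeff_C_mul, coeff_reverse,
    revAt_le (by omega), show P.natDegree - (P.natDegree - 1) = 1 by omega]
  field_simp

noncomputable def lamK {k : Type*} [Field k] (a b : k) (f : k[X]) : k :=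
  -(a * f.nextCoeff) - b * (f.coeff 1 / f.coeff 0)

open Classical in
noncomputable def LamK {k : Type*} [Field k] (ψ : AddChar k ℂ) (a b : k) (f : k[X]) : ℂ :=
  if f.coeff 0 = 0 then 0 else ψ (lamK a b f)

lemma LamK_one {k : Type*} [Field k] (ψ : AddChar k ℂ) (a b : k) : LamK ψ a b 1 = 1 := by
  have : (1 : k[X]).nextCoeff = 0 := by simpa using nextCoeff_C_eq_zero (1 : k)
  simp [LamK, lamK, this, coeff_one]

lemma LamK_mul {k : Type*} [Field k] (ψ : AddChar k ℂ) (a b : k) (f g : k[X]) (hf : f.Monic)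
    (hg : g.Monic) : LamK ψ a b (f * g) = LamK ψ a b f * LamK ψ a b g := by
  unfold LamK
  rw [mul_coeff_zero]
  by_cases h1 : f.coeff 0 = 0
  · simp [h1]
  by_cases h2 : g.coeff 0 = 0
  · simp [h2]
  rw [if_neg (mul_ne_zero h1 h2), if_neg h1, if_neg h2, ← AddChar.map_add_eq_mul]
  congr 1
  unfold lamK
  rw [hf.nextCoeff_mul hg, mul_coeff_one, mul_coeff_zero]
  field_simp
  ring

lemma LamK_pow {k : Type*} [Field k] (ψ : AddChar k ℂ) (a b : k) (f : k[X]) (hf : f.Monic)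
    (n : ℕ) : LamK ψ a b (f ^ n) = LamK ψ a b f ^ n := by
  induction n with
  | zero => simp [LamK_one]
  | succ n ih => rw [pow_succ, LamK_mul _ _ _ _ _ (hf.pow n) hf, ih, pow_succ]

lemma trace_lam {k L : Type*} [Field k] [Field L] [Algebra k L] [FiniteDimensional k L]
    (a b : k) (x : L) (hx : x ≠ 0) :
    Algebra.trace k L (algebraMap k L a * x + algebraMap k L b * x⁻¹) =
      (Module.finrank k L / (minpoly k x).natDegree) • lamK a b (minpoly k x) := by
  have hi : IsIntegral k x := IsIntegral.of_finite k x
  have h0 : Module.finrank (IntermediateField.adjoin k {x}) L =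
      Module.finrank k L / (minpoly k x).natDegree := by
    rw [← IntermediateField.adjoin.finrank hi,
      ← Module.finrank_mul_finrank k (IntermediateField.adjoin k {x}) L,
      Nat.mul_div_cancel_left _ Module.finrank_pos]
  rw [map_add, ← Algebra.smul_def, ← Algebra.smul_def, map_smul, map_smul,
    trace_eq_finrank_mul_minpoly_nextCoeff, trace_eq_finrank_mul_minpoly_nextCoeff,
    nextCoeff_minpoly_inv x hx, adjoin_inv_eq, h0, lamK, nsmul_eq_mul, smul_eq_mul, smul_eq_mul]
  ring

open Classical in
noncomputable def Mon (k : Type*) [Field k] [Fintype k] (n : ℕ) : Finset k[X] :=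
  Finset.univ.image (fun c : Fin n → k => X ^ n + ∑ i : Fin n, C (c i) * X ^ (i : ℕ))

lemma mon_aux_deg {k : Type*} [Field k] {n : ℕ} (c : Fin n → k) :
    (∑ i : Fin n, C (c i) * X ^ (i : ℕ)).degree < (n : WithBot ℕ) := by
  rw [← mem_degreeLT]
  refine Submodule.sum_mem _ fun e _ => ?_
  rw [mem_degreeLT]
  refine lt_of_le_of_lt (degree_C_mul_X_pow_le _ _) ?_
  exact_mod_cast e.2

lemma mon_aux_coeff {k : Type*} [Field k] {n : ℕ} (c : Fin n → k) (i : Fin n) :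
    (X ^ n + ∑ i : Fin n, C (c i) * X ^ (i : ℕ)).coeff i = c i := by
  rw [coeff_add, coeff_X_pow, if_neg (by have := i.2; omega), zero_add, finsetSum_coeff,
    Finset.sum_eq_single i]
  · simp
  · intro j _ hj
    rw [coeff_C_mul, coeff_X_pow, if_neg (fun h => hj (Fin.ext h.symm)), mul_zero]
  · simp

lemma mem_Mon {k : Type*} [Field k] [Fintype k] {n : ℕ} {f : k[X]} :
    f ∈ Mon k n ↔ f.Monic ∧ f.natDegree = n := by
  classical
  simp only [Mon, Finset.mem_image, Finset.mem_univ, true_and]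
  constructor
  · rintro ⟨c, rfl⟩
    have h := mon_aux_deg c
    refine ⟨monic_X_pow_add h, ?_⟩
    have h2 : (X ^ n + ∑ i : Fin n, C (c i) * X ^ (i : ℕ)).degree = n := by
      rw [degree_add_eq_left_of_degree_lt (by rwa [degree_X_pow]), degree_X_pow]
    exact natDegree_eq_of_degree_eq_some h2
  · rintro ⟨hm, hd⟩
    refine ⟨fun i => f.coeff i, ?_⟩
    conv_rhs => rw [hm.as_sum, hd]
    rw [Finset.sum_range]

lemma Mon_sum {k : Type*} [Field k] [Fintype k] (n : ℕ) (g : k[X] → ℂ) :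
    ∑ f ∈ Mon k n, g f = ∑ c : Fin n → k, g (X ^ n + ∑ i : Fin n, C (c i) * X ^ (i : ℕ)) := by
  classical
  rw [Mon, Finset.sum_image]
  intro c _ c' _ h
  funext i
  rw [← mon_aux_coeff c i, ← mon_aux_coeff c' i]
  exact congrArg (fun q => coeff q (i : ℕ)) h

noncomputable def AK {k : Type*} [Field k] [Fintype k] (ψ : AddChar k ℂ) (a b : k) (n : ℕ) : ℂ :=
  ∑ f ∈ Mon k n, LamK ψ a b f

open Classical in
noncomputable def IrrM (k : Type*) [Field k] [Fintype k] (n : ℕ) : Finset k[X] :=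
  ((Finset.range (n + 1)).biUnion (Mon k)).filter Irreducible

lemma mem_IrrM {k : Type*} [Field k] [Fintype k] {n : ℕ} {f : k[X]} :
    f ∈ IrrM k n ↔ f.Monic ∧ Irreducible f ∧ f.natDegree ≤ n := by
  simp only [IrrM, Finset.mem_filter, Finset.mem_biUnion, Finset.mem_range, mem_Mon]
  constructor
  · rintro ⟨⟨d, h1, h2, h3⟩, h4⟩; exact ⟨h2, h4, by omega⟩
  · rintro ⟨h2, h4, h5⟩; exact ⟨⟨_, by omega, h2, rfl⟩, h4⟩

open Classical in
lemma deg_count {k : Type*} [Field k] [Fintype k] {n : ℕ} {f : k[X]} (hf : f.Monic)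
    (hn : f.natDegree = n) :
    n = ∑ P ∈ IrrM k n, ∑ j ∈ Finset.Icc 1 n, if P ^ j ∣ f then P.natDegree else 0 := by
  have hf0 : f ≠ 0 := hf.ne_zero
  set s := UniqueFactorizationMonoid.normalizedFactors f with hs
  have hprod : s.prod = f := by
    rw [hs, UniqueFactorizationMonoid.prod_normalizedFactors_eq hf0, hf.normalize_eq_self]
  have hirr : ∀ P ∈ s, Irreducible P := fun P hP =>
    UniqueFactorizationMonoid.irreducible_of_normalized_factor P hP
  have hmon : ∀ P ∈ s, P.Monic := fun P hP => by
    have := UniqueFactorizationMonoid.normalize_normalized_factor P hP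
    rw [← this]; exact monic_normalize (hirr P hP).ne_zero
  have h1 : n = ∑ P ∈ s.toFinset, s.count P * P.natDegree := by
    rw [← hn]
    conv_lhs => rw [← hprod]
    rw [natDegree_multiset_prod_of_monic _ hmon, Finset.sum_multiset_map_count]
    simp
  have hcount : ∀ P ∈ IrrM k n,
      (∑ j ∈ Finset.Icc 1 n, if P ^ j ∣ f then P.natDegree else 0) = s.count P * P.natDegree := by
    intro P hP
    obtain ⟨hPm, hPi, hPd⟩ := mem_IrrM.1 hP
    have hiff : ∀ j, P ^ j ∣ f ↔ j ≤ s.count P := by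
      intro j
      rw [pow_dvd_iff_le_emultiplicity,
        UniqueFactorizationMonoid.le_emultiplicity_iff_replicate_le_normalizedFactors hPi hf0,
        hPm.normalize_eq_self, Multiset.le_count_iff_replicate_le]
    have hle : s.count P ≤ n := by
      have h2 := natDegree_le_of_dvd ((hiff _).2 le_rfl) hf0
      rw [natDegree_pow, hn] at h2
      have := hPi.natDegree_pos
      nlinarith
    rw [← Finset.sum_filter, Finset.sum_const, smul_eq_mul]
    congr 1
    rw [show (Finset.Icc 1 n).filter (fun j => P ^ j ∣ f) = Finset.Icc 1 (s.count P) by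
      ext j; simp only [Finset.mem_filter, Finset.mem_Icc, hiff]; omega]
    simp
  rw [Finset.sum_congr rfl hcount]
  conv_lhs => rw [h1]
  refine Finset.sum_subset ?_ ?_
  · intro P hP
    rw [Multiset.mem_toFinset] at hP
    refine mem_IrrM.2 ⟨hmon P hP, hirr P hP, ?_⟩
    rw [← hn]
    exact natDegree_le_of_dvd (UniqueFactorizationMonoid.dvd_of_mem_normalizedFactors hP) hf0
  · intro P _ hP
    rw [Multiset.mem_toFinset] at hP
    rw [Multiset.count_eq_zero_of_notMem hP, zero_mul]

open Classical in
noncomputable def KcK {k : Type*} [Field k] [Fintype k] (ψ : AddChar k ℂ) (a b : k) (j : ℕ) : ℂ :=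
  ∑ P ∈ (IrrM k j).filter (fun P => P.natDegree ∣ j),
    (P.natDegree : ℂ) * LamK ψ a b P ^ (j / P.natDegree)

open Classical in
lemma sum_dvd_mon {k : Type*} [Field k] [Fintype k] (ψ : AddChar k ℂ) (a b : k) (n j : ℕ)
    (P : k[X]) (hP : P.Monic) :
    ∑ f ∈ Mon k n, (if P ^ j ∣ f then LamK ψ a b f else 0) =
      if j * P.natDegree ≤ n then LamK ψ a b P ^ j * AK ψ a b (n - j * P.natDegree) else 0 := by
  have hPj : (P ^ j).Monic := hP.pow j
  split_ifs with h
  · rw [← Finset.sum_filter, AK, Finset.mul_sum]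
    symm
    refine Finset.sum_bij (fun g _ => P ^ j * g) ?_ ?_ ?_ ?_
    · intro g hg
      obtain ⟨h1, h2⟩ := mem_Mon.1 hg
      refine Finset.mem_filter.2 ⟨mem_Mon.2 ⟨hPj.mul h1, ?_⟩, dvd_mul_right _ _⟩
      rw [hPj.natDegree_mul h1, hP.natDegree_pow, h2]; omega
    · intro g _ g' _ hh
      exact mul_left_cancel₀ hPj.ne_zero hh
    · intro f hf
      obtain ⟨h1, g, rfl⟩ := Finset.mem_filter.1 hf
      obtain ⟨h1, h2⟩ := mem_Mon.1 h1
      have hg : g.Monic := hPj.of_mul_monic_left h1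
      refine ⟨g, mem_Mon.2 ⟨hg, ?_⟩, rfl⟩
      rw [hPj.natDegree_mul hg, hP.natDegree_pow] at h2; omega
    · intro g hg
      obtain ⟨h1, h2⟩ := mem_Mon.1 hg
      rw [LamK_mul _ _ _ _ _ hPj h1, LamK_pow _ _ _ _ hP]
  · refine Finset.sum_eq_zero fun f hf => ?_
    obtain ⟨h1, h2⟩ := mem_Mon.1 hf
    rw [if_neg]
    intro hd
    have := natDegree_le_of_dvd hd h1.ne_zero
    rw [hP.natDegree_pow] at this
    omega

lemma newtonK {k : Type*} [Field k] [Fintype k] (ψ : AddChar k ℂ) (a b : k) (n : ℕ) :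
    (n : ℂ) * AK ψ a b n = ∑ j ∈ Finset.Icc 1 n, KcK ψ a b j * AK ψ a b (n - j) := by
  classical
  have h1 : (n : ℂ) * AK ψ a b n = ∑ P ∈ IrrM k n, ∑ j ∈ Finset.Icc 1 n, (P.natDegree : ℂ) *
      ∑ f ∈ Mon k n, (if P ^ j ∣ f then LamK ψ a b f else 0) := by
    simp only [AK, Finset.mul_sum]
    have : ∀ f ∈ Mon k n, (n : ℂ) * LamK ψ a b f = ∑ P ∈ IrrM k n, ∑ j ∈ Finset.Icc 1 n,
        (P.natDegree : ℂ) * (if P ^ j ∣ f then LamK ψ a b f else 0) := by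
      intro f hf
      obtain ⟨h1, h2⟩ := mem_Mon.1 hf
      have h3 := congrArg (Nat.cast : ℕ → ℂ) (deg_count h1 h2)
      rw [h3]
      push_cast
      rw [Finset.sum_mul]
      refine Finset.sum_congr rfl fun P _ => ?_
      rw [Finset.sum_mul]
      refine Finset.sum_congr rfl fun j _ => ?_
      split_ifs <;> simp
    rw [Finset.sum_congr rfl this, Finset.sum_comm]
    refine Finset.sum_congr rfl fun P _ => ?_
    rw [Finset.sum_comm]
  rw [h1]
  have h2 : ∀ P ∈ IrrM k n, ∑ j ∈ Finset.Icc 1 n, (P.natDegree : ℂ) *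
      ∑ f ∈ Mon k n, (if P ^ j ∣ f then LamK ψ a b f else 0) =
      ∑ j ∈ Finset.Icc 1 n, if P.natDegree ∣ j then
        (P.natDegree : ℂ) * LamK ψ a b P ^ (j / P.natDegree) * AK ψ a b (n - j) else 0 := by
    intro P hP
    obtain ⟨hPm, hPi, hPd⟩ := mem_IrrM.1 hP
    have hpos := hPi.natDegree_pos
    simp only [sum_dvd_mon _ _ _ _ _ P hPm]
    rw [← Finset.sum_filter]
    have : ∀ j ∈ Finset.Icc 1 n, (P.natDegree : ℂ) * (if j * P.natDegree ≤ n then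
        LamK ψ a b P ^ j * AK ψ a b (n - j * P.natDegree) else 0) = if j * P.natDegree ≤ n then
        (P.natDegree : ℂ) * (LamK ψ a b P ^ j * AK ψ a b (n - j * P.natDegree)) else 0 := by
      intro j _; split_ifs <;> simp
    rw [Finset.sum_congr rfl this, ← Finset.sum_filter]
    refine Finset.sum_bij (fun j _ => j * P.natDegree) ?_ ?_ ?_ ?_
    · intro j hj
      simp only [Finset.mem_filter, Finset.mem_Icc] at hj ⊢
      exact ⟨⟨by nlinarith, hj.2⟩, dvd_mul_left _ _⟩
    · intro j _ j' _ h
      exact Nat.eq_of_mul_eq_mul_right hpos h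
    · intro j hj
      simp only [Finset.mem_filter, Finset.mem_Icc] at hj
      obtain ⟨⟨h1, h2⟩, c, rfl⟩ := hj
      refine ⟨c, ?_, mul_comm _ _⟩
      simp only [Finset.mem_filter, Finset.mem_Icc]
      have : c ≠ 0 := by rintro rfl; simp at h1
      exact ⟨⟨by omega, by nlinarith⟩, by rwa [mul_comm]⟩
    · intro j _
      rw [Nat.mul_div_cancel _ hpos]; ring
  rw [Finset.sum_congr rfl h2, Finset.sum_comm]
  refine Finset.sum_congr rfl fun j hj => ?_
  rw [KcK, Finset.sum_mul, ← Finset.sum_filter]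
  refine Finset.sum_congr ?_ fun _ _ => rfl
  ext P
  have hj' := Finset.mem_Icc.1 hj
  simp only [Finset.mem_filter, mem_IrrM]
  constructor
  · rintro ⟨⟨h1, h2, h3⟩, h4⟩
    exact ⟨⟨h1, h2, Nat.le_of_dvd (by omega) h4⟩, h4⟩
  · rintro ⟨⟨h1, h2, h3⟩, h4⟩
    exact ⟨⟨h1, h2, by omega⟩, h4⟩

open Classical in
lemma KcK_eq {k L : Type*} [Field k] [Fintype k] [Field L] [Fintype L] [Algebra k L]
    (ψ : AddChar k ℂ) (a b : k) :
    KcK ψ a b (Module.finrank k L) = ∑ x : L, if x = 0 then 0 else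
      ψ (Algebra.trace k L (algebraMap k L a * x + algebraMap k L b * x⁻¹)) := by
  have hint : ∀ x : L, IsIntegral k x := fun x => IsIntegral.of_finite k x
  rw [← Finset.sum_fiberwise_of_maps_to (g := fun x : L => minpoly k x)
    (t := (IrrM k (Module.finrank k L)).filter (fun P => P.natDegree ∣ Module.finrank k L))]
  · rw [KcK]
    refine Finset.sum_congr rfl fun P hP => ?_
    obtain ⟨hP1, hdvd⟩ := Finset.mem_filter.1 hP
    obtain ⟨hPm, hPi, hPd⟩ := mem_IrrM.1 hP1
    have hterm : ∀ x ∈ Finset.univ.filter (fun x : L => minpoly k x = P),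
        (if x = 0 then 0 else
      ψ (Algebra.trace k L (algebraMap k L a * x + algebraMap k L b * x⁻¹))) =
        LamK ψ a b P ^ (Module.finrank k L / P.natDegree) := by
      intro x hx
      have hx' := (Finset.mem_filter.1 hx).2
      by_cases h0 : x = 0
      · have : P.coeff 0 = 0 := by rw [← hx', minpoly.coeff_zero_eq_zero (hint x)]; exact h0
        rw [if_pos h0, LamK, if_pos this, zero_pow]
        have := Nat.div_pos hPd hPi.natDegree_pos
        omega
      · have : P.coeff 0 ≠ 0 := by
          rw [← hx']; exact fun h => h0 ((minpoly.coeff_zero_eq_zero (hint x)).1 h)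
        rw [if_neg h0, LamK, if_neg this, trace_lam a b x h0, AddChar.map_nsmul_eq_pow, hx']
    rw [Finset.sum_congr rfl hterm, Finset.sum_const, nsmul_eq_mul]
    congr 2
    -- count of roots
    have : Fact (Irreducible P) := ⟨hPi⟩
    have : Finite (AdjoinRoot P) := by
      have := (AdjoinRoot.powerBasis hPi.ne_zero).finite
      exact Module.finite_of_finite k
    have hfr : Module.finrank k (AdjoinRoot P) = P.natDegree := by
      rw [(AdjoinRoot.powerBasis hPi.ne_zero).finrank, AdjoinRoot.powerBasis_dim]
    obtain ⟨φ⟩ := FiniteField.nonempty_algHom_of_finrank_dvd (F := k) (K := AdjoinRoot P) (L := L)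
      (by rw [hfr]; exact hdvd)
    have hroot : aeval (φ (AdjoinRoot.root P)) P = 0 := by
      rw [aeval_algHom_apply]; simp
    have hmin := minpoly.eq_of_irreducible_of_monic hPi hroot hPm
    have hspl : (P.map (algebraMap k L)).Splits := by
      have hN : Normal k L := inferInstance
      have := hN.splits (φ (AdjoinRoot.root P))
      rwa [← hmin] at this
    have hsep : P.Separable := PerfectField.separable_of_irreducible hPi
    rw [← card_rootSet_eq_natDegree hsep hspl, ← Set.toFinset_card]
    congr 1
    ext x
    simp only [Set.mem_toFinset, Finset.mem_filter, Finset.mem_univ, true_and,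
      mem_rootSet]
    constructor
    · intro h
      exact (minpoly.eq_of_irreducible_of_monic hPi h.2 hPm).symm
    · intro h
      exact ⟨hPi.ne_zero, by rw [← h]; exact minpoly.aeval k x⟩
  · intro x _
    refine Finset.mem_filter.2 ⟨mem_IrrM.2 ⟨minpoly.monic (hint x), minpoly.irreducible (hint x),
      minpoly.natDegree_le x⟩, ?_⟩
    rw [← IntermediateField.adjoin.finrank (hint x),
      ← Module.finrank_mul_finrank k (IntermediateField.adjoin k {x}) L]
    exact dvd_mul_right _ _

end partA2

section partA3

open Polynomial

lemma AK_zero {k : Type*} [Field k] [Fintype k] (ψ : AddChar k ℂ) (a b : k) : AK ψ a b 0 = 1 := by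
  rw [AK, Mon_sum]
  simp [LamK_one]

lemma AK_two {k : Type*} [Field k] [Fintype k] (ψ : AddChar k ℂ) (hψ : ψ ≠ 1) (a b : k)
    (ha : a ≠ 0) (hb : b ≠ 0) : AK ψ a b 2 = Fintype.card k := by
  classical
  rw [AK, Mon_sum, ← (finTwoArrowEquiv k).symm.sum_comp, Fintype.sum_prod_type]
  have hval : ∀ c0 c1 : k, LamK ψ a b (X ^ 2 + ∑ i : Fin 2,
      C ((finTwoArrowEquiv k).symm (c0, c1) i) * X ^ (i : ℕ)) =
      if c0 = 0 then 0 else ψ (c1 * -(a + b / c0)) := by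
    intro c0 c1
    set f := X ^ 2 + ∑ i : Fin 2, C ((finTwoArrowEquiv k).symm (c0, c1) i) * X ^ (i : ℕ) with hf
    have h0 : f.coeff 0 = c0 := by
      simp [hf]
    have h1 : f.coeff 1 = c1 := by
      simp [hf]
    have hmem : f ∈ Mon k 2 := by
      rw [Mon, Finset.mem_image]; exact ⟨_, Finset.mem_univ _, rfl⟩
    have hd := (mem_Mon.1 hmem).2
    have hn : f.nextCoeff = c1 := by
      rw [nextCoeff_of_natDegree_pos (by omega), hd]; exact h1
    rw [LamK, lamK, h0, h1, hn]
    split_ifs with h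
    · rfl
    · congr 1; ring
  simp only [hval]
  have hprim := AddChar.IsPrimitive.of_ne_one hψ
  have hin : ∀ c0 : k, (∑ c1 : k, if c0 = 0 then 0 else ψ (c1 * -(a + b / c0))) =
      if c0 = -b / a then (Fintype.card k : ℂ) else 0 := by
    intro c0
    by_cases h : c0 = 0
    · have : ¬ (0 = -b / a) := by
        intro h; exact (div_ne_zero (neg_ne_zero.2 hb) ha) h.symm
      simp [h, this]
    · simp only [if_neg h]
      rw [AddChar.sum_mulShift _ hprim]
      have : (-(a + b / c0) = 0) ↔ c0 = -b / a := by
        rw [neg_eq_zero, eq_div_iff ha]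
        constructor
        · intro h'
          field_simp at h'
          linear_combination h'
        · intro h'
          field_simp
          linear_combination h'
      by_cases h2 : c0 = -b / a
      · rw [if_pos (this.2 h2), if_pos h2]
      · rw [if_neg (fun h => h2 (this.1 h)), if_neg h2]; simp
  simp only [hin, Finset.sum_ite_eq', Finset.mem_univ, if_true]

lemma AK_ge_three {k : Type*} [Field k] [Fintype k] (ψ : AddChar k ℂ) (hψ : ψ ≠ 1) (a b : k)
    (ha : a ≠ 0) (n : ℕ) (hn : 3 ≤ n) : AK ψ a b n = 0 := by
  obtain ⟨z, hz⟩ := AddChar.ne_one_iff.1 hψ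
  set t : k := -z / a
  have ht : -(a * t) = z := by simp only [t]; field_simp
  have hmem : ∀ (u : k) (f : k[X]), f ∈ Mon k n → f + C u * X ^ (n - 1) ∈ Mon k n := by
    intro u f hf
    obtain ⟨h1, h2⟩ := mem_Mon.1 hf
    have hlt : (C u * X ^ (n - 1)).degree < f.degree := by
      rw [degree_eq_natDegree h1.ne_zero, h2]
      refine lt_of_le_of_lt (degree_C_mul_X_pow_le _ _) ?_
      have : n - 1 < n := by omega
      exact_mod_cast this
    refine mem_Mon.2 ⟨h1.add_of_left hlt, ?_⟩
    rw [natDegree_eq_of_degree_eq (degree_add_eq_left_of_degree_lt hlt), h2]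
  have hL : ∀ f ∈ Mon k n, LamK ψ a b (f + C t * X ^ (n - 1)) = ψ z * LamK ψ a b f := by
    intro f hf
    obtain ⟨h1, h2⟩ := mem_Mon.1 hf
    obtain ⟨h3, h4⟩ := mem_Mon.1 (hmem t f hf)
    have c0 : (f + C t * X ^ (n - 1)).coeff 0 = f.coeff 0 := by
      rw [coeff_add, coeff_C_mul, coeff_X_pow, if_neg (by omega)]; simp
    have c1 : (f + C t * X ^ (n - 1)).coeff 1 = f.coeff 1 := by
      rw [coeff_add, coeff_C_mul, coeff_X_pow, if_neg (by omega)]; simp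
    have c2 : (f + C t * X ^ (n - 1)).nextCoeff = f.nextCoeff + t := by
      rw [nextCoeff_of_natDegree_pos (by omega), nextCoeff_of_natDegree_pos (by omega), h4, h2,
        coeff_add, coeff_C_mul, coeff_X_pow, if_pos rfl, mul_one]
    rw [LamK, LamK, lamK, c0, c1, c2]
    split_ifs with h
    · simp
    · rw [← AddChar.map_add_eq_mul, lamK, ← ht]; congr 1; ring
  have h : AK ψ a b n = ψ z * AK ψ a b n := by
    rw [AK, Finset.mul_sum, ← Finset.sum_congr rfl hL]
    symm
    refine Finset.sum_bij' (fun f _ => f + C t * X ^ (n - 1)) (fun f _ => f + C (-t) * X ^ (n - 1))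
      (fun f hf => hmem t f hf) (fun f hf => hmem (-t) f hf) ?_ ?_ ?_
    · intro f _; simp
    · intro f _; simp
    · intro f _; rfl
  have h2 : (1 - ψ z) * AK ψ a b n = 0 := by linear_combination h
  exact (mul_eq_zero.1 h2).resolve_left (sub_ne_zero.2 (Ne.symm hz))

lemma KcK_roots {k : Type*} [Field k] [Fintype k] (ψ : AddChar k ℂ) (hψ : ψ ≠ 1) (a b : k)
    (ha : a ≠ 0) (hb : b ≠ 0) (α β : ℂ) (h1 : α + β = - KcK ψ a b 1) (h2 : α * β = Fintype.card k) :
    ∀ n : ℕ, 1 ≤ n → KcK ψ a b n = -(α ^ n + β ^ n) := by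
  have hA1 : AK ψ a b 1 = KcK ψ a b 1 := by
    have := newtonK ψ a b 1
    simpa [AK_zero] using this
  intro n
  induction n using Nat.strong_induction_on with
  | _ n ih =>
    intro hn
    rcases (show n = 1 ∨ n = 2 ∨ 3 ≤ n by omega) with rfl | rfl | h3
    · rw [pow_one, pow_one, h1]; ring
    · have := newtonK ψ a b 2
      rw [show Finset.Icc 1 2 = {1, 2} by decide, Finset.sum_pair (by decide)] at this
      simp only [Nat.sub_self, AK_zero, show 2 - 1 = 1 from rfl, hA1, AK_two ψ hψ a b ha hb] at this
      rw [← h2] at this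
      push_cast at this
      linear_combination (α + β - KcK ψ a b 1) * h1 - this
    · have := newtonK ψ a b n
      rw [AK_ge_three ψ hψ a b ha n h3, mul_zero] at this
      obtain ⟨m, rfl⟩ : ∃ m, n = m + 3 := ⟨n - 3, by omega⟩
      rw [Finset.sum_Icc_succ_top (by omega), Finset.sum_Icc_succ_top (by omega),
        Finset.sum_Icc_succ_top (by omega), Finset.sum_eq_zero] at this
      · simp only [Nat.sub_self, AK_zero, show m + 2 + 1 - (m + 1 + 1) = 1 by omega,
          show m + 2 + 1 - (m + 1) = 2 by omega, hA1, AK_two ψ hψ a b ha hb] at this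
        rw [ih (m + 1) (by omega) (by omega), ih (m + 1 + 1) (by omega) (by omega), ← h2] at this
        have e : KcK ψ a b (m + 3) = KcK ψ a b (m + 2 + 1) := rfl
        rw [e]
        linear_combination -this + (α ^ (m + 2) + β ^ (m + 2)) * h1
      · intro j hj
        have := Finset.mem_Icc.1 hj
        rw [AK_ge_three ψ hψ a b ha _ (by omega), mul_zero]

lemma KcK_bound (p : ℕ) [hp : Fact p.Prime] (ψ : AddChar (ZMod p) ℂ) (hψ : ψ ≠ 1) (a b : ZMod p)
    (ha : a ≠ 0) (m : ℕ) (hm : 3 ≤ m) : ‖KcK ψ a b (2 * m)‖ ≤ 4 * p * (p : ℝ) ^ m := by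
  classical
  let L := GaloisField p (2 * m)
  have hfr : Module.finrank (ZMod p) L = 2 * m := GaloisField.finrank p (by omega)
  let _ : Fintype L := Fintype.ofFinite L
  have hcard : Fintype.card L = p ^ (2 * m) := by
    rw [← Nat.card_eq_fintype_card]; exact GaloisField.card p (2 * m) (by omega)
  have hK := KcK_eq (k := ZMod p) (L := L) ψ a b
  rw [hfr] at hK
  set g : L → ZMod p := fun x => Algebra.trace (ZMod p) L
    (algebraMap (ZMod p) L a * x + algebraMap (ZMod p) L b * x⁻¹) with hg
  set N : ZMod p → ℕ := fun c => (Finset.univ.filter (fun x : L => x ≠ 0 ∧ g x = c)).card with hN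
  have hNle : ∀ c, N c ≤ p ^ (2 * m - 1) + 3 * p ^ m := by
    intro c
    have hst := stepanov (F := L) p m hm hcard (algebraMap (ZMod p) L a) (algebraMap (ZMod p) L b)
      (algebraMap (ZMod p) L c) (by rw [← map_pow, ZMod.pow_card]) (by rw [← map_pow, ZMod.pow_card])
      (by simpa using ha)
    refine le_trans (le_of_eq ?_) hst
    simp only [hN]
    congr 1
    ext x
    simp only [Finset.mem_filter, Finset.mem_univ, true_and]
    refine and_congr_right fun _ => ?_
    rw [← (algebraMap (ZMod p) L).injective.eq_iff, hg]
    simp only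
    rw [FiniteField.algebraMap_trace_eq_sum_pow, hfr, Nat.card_zmod]
  have hsum : ∑ c, N c = p ^ (2 * m) - 1 := by
    have h1 := Finset.card_eq_sum_card_fiberwise (s := Finset.univ.filter (fun x : L => x ≠ 0))
      (t := Finset.univ) (f := g) (fun x _ => Finset.mem_coe.2 (Finset.mem_univ _))
    simp only [Finset.filter_filter] at h1
    rw [show ∑ c, N c = _ from h1.symm, ← hcard, Finset.filter_ne', Finset.card_erase_of_mem
      (Finset.mem_univ _), Finset.card_univ]
  have hK2 : KcK ψ a b (2 * m) = ∑ c, (N c : ℂ) * ψ c := by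
    rw [hK]
    have h1 := Finset.sum_fiberwise_of_maps_to (s := (Finset.univ : Finset L))
      (t := Finset.univ) (g := g) (fun x _ => Finset.mem_univ _)
      (fun x => if x = 0 then (0 : ℂ) else ψ (g x))
    rw [← h1]
    refine Finset.sum_congr rfl fun c _ => ?_
    simp only [hN]
    rw [Finset.card_eq_sum_ones]
    push_cast
    rw [Finset.sum_mul, Finset.sum_filter, Finset.sum_filter]
    refine Finset.sum_congr rfl fun x _ => ?_
    by_cases h0 : x = 0
    · simp [h0]
    · by_cases h : g x = c <;> simp [h0, h]
  have hψ0 : ∑ c, ψ c = 0 := AddChar.sum_eq_zero_of_ne_one hψ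
  set W : ℕ := p ^ (2 * m - 1) + 3 * p ^ m with hW
  have hK3 : KcK ψ a b (2 * m) = - ∑ c, ((W - N c : ℝ) : ℂ) * ψ c := by
    rw [hK2]
    push_cast
    simp only [sub_mul, Finset.sum_sub_distrib, ← Finset.mul_sum, hψ0]
    ring
  rw [hK3, norm_neg]
  refine (norm_sum_le _ _).trans ?_
  have h4 : ∀ c, ‖((W - N c : ℝ) : ℂ) * ψ c‖ = (W - N c : ℝ) := by
    intro c
    have : (N c : ℝ) ≤ W := by exact_mod_cast hNle c
    rw [norm_mul, AddChar.norm_apply, mul_one, Complex.norm_real, Real.norm_of_nonneg (by linarith)]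
  simp only [h4, Finset.sum_sub_distrib, Finset.sum_const, Finset.card_univ, ZMod.card, nsmul_eq_mul]
  have h5 : (∑ c, (N c : ℝ)) = (p : ℝ) ^ (2 * m) - 1 := by
    have : ((∑ c, N c : ℕ) : ℝ) = _ := congrArg Nat.cast hsum
    rw [Nat.cast_sub (Nat.one_le_pow _ _ hp.out.pos)] at this
    push_cast at this; exact this
  rw [h5, hW]
  push_cast
  have h6 : (p : ℝ) ^ (2 * m) = p * p ^ (2 * m - 1) := by
    rw [← pow_succ']; congr 1; omega
  have hp1 : (1 : ℝ) ≤ p := by exact_mod_cast hp.out.one_le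
  have h7 : (1 : ℝ) ≤ (p : ℝ) ^ m := one_le_pow₀ hp1
  rw [h6]
  nlinarith

lemma root_bound (p : ℝ) (hp : 1 ≤ p) (α β : ℂ) (h2 : α * β = p)
    (hb : ∀ m : ℕ, 3 ≤ m → ‖α ^ (2 * m) + β ^ (2 * m)‖ ≤ 4 * p * p ^ m) : ‖α‖ ^ 2 ≤ p := by
  by_contra hcon
  push Not at hcon
  have hp0 : 0 < p := by linarith
  have hn : ‖α‖ * ‖β‖ = p := by
    rw [← norm_mul, h2, Complex.norm_real, Real.norm_of_nonneg hp0.le]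
  have hβ : ‖β‖ ^ 2 ≤ p := by
    by_contra h
    push Not at h
    have : p * p < ‖α‖ ^ 2 * ‖β‖ ^ 2 := by nlinarith
    rw [← mul_pow, hn] at this
    nlinarith
  have hr : 1 < ‖α‖ ^ 2 / p := by rwa [one_lt_div hp0]
  obtain ⟨n, hn'⟩ := pow_unbounded_of_one_lt (5 * p) hr
  have h3 : (‖α‖ ^ 2 / p) ^ n ≤ (‖α‖ ^ 2 / p) ^ (n + 3) := pow_le_pow_right₀ hr.le (by omega)
  have h4 := hb (n + 3) (by omega)
  have h5 : ‖α‖ ^ (2 * (n + 3)) ≤ 5 * p * p ^ (n + 3) := by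
    have e : α ^ (2 * (n + 3)) = (α ^ (2 * (n + 3)) + β ^ (2 * (n + 3))) - β ^ (2 * (n + 3)) := by
      ring
    rw [← norm_pow, e]
    refine (norm_sub_le _ _).trans ?_
    have h6 : ‖β ^ (2 * (n + 3))‖ ≤ p ^ (n + 3) := by
      rw [norm_pow, pow_mul]; exact pow_le_pow_left₀ (by positivity) hβ _
    have : 0 < p ^ (n + 3) := by positivity
    nlinarith
  have h7 : (‖α‖ ^ 2 / p) ^ (n + 3) ≤ 5 * p := by
    rw [div_pow, div_le_iff₀ (by positivity), ← pow_mul]; exact h5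
  linarith

theorem weil_kloosterman (p : ℕ) [hp : Fact p.Prime] (ψ : AddChar (ZMod p) ℂ) (hψ : ψ ≠ 1)
    (a b : ZMod p) (ha : a ≠ 0) (hb : b ≠ 0) :
    ‖∑ u : (ZMod p)ˣ, ψ (a * u + b * (u⁻¹ : (ZMod p)ˣ))‖ ≤ 2 * Real.sqrt p := by
  classical
  have hp1 : (1 : ℝ) ≤ p := by exact_mod_cast hp.out.one_le
  have hK1 : ∑ u : (ZMod p)ˣ, ψ (a * u + b * (u⁻¹ : (ZMod p)ˣ)) = KcK ψ a b 1 := by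
    have h := KcK_eq (k := ZMod p) (L := ZMod p) ψ a b
    rw [Module.finrank_self] at h
    rw [h]
    have : ∀ x : ZMod p, Algebra.trace (ZMod p) (ZMod p) x = x := by
      intro x; rw [Algebra.trace_self_apply]
    simp only [Algebra.algebraMap_self, RingHom.id_apply, this]
    have hsub : (∑ x : ZMod p, if x = 0 then (0 : ℂ) else ψ (a * x + b * x⁻¹)) =
        ∑ x ∈ Finset.univ.filter (fun x : ZMod p => x ≠ 0), ψ (a * x + b * x⁻¹) := by
      rw [Finset.sum_filter]
      refine Finset.sum_congr rfl fun x _ => ?_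
      by_cases hx : x = 0 <;> simp [hx]
    rw [hsub]
    refine Finset.sum_bij (fun u _ => (u : ZMod p)) ?_ ?_ ?_ ?_
    · intro u _; exact Finset.mem_filter.2 ⟨Finset.mem_univ _, u.ne_zero⟩
    · intro u _ v _ h; exact Units.ext h
    · intro x hx
      exact ⟨Units.mk0 x (Finset.mem_filter.1 hx).2, Finset.mem_univ _, rfl⟩
    · intro u _; rw [Units.val_inv_eq_inv_val]
  rw [hK1]
  obtain ⟨s, hs⟩ := IsAlgClosed.exists_pow_nat_eq ((KcK ψ a b 1) ^ 2 - 4 * (p : ℂ)) (n := 2)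
    (by norm_num)
  set α := (-(KcK ψ a b 1) + s) / 2 with hα
  set β := (-(KcK ψ a b 1) - s) / 2 with hβ
  have h1 : α + β = - KcK ψ a b 1 := by rw [hα, hβ]; ring
  have h2 : α * β = p := by rw [hα, hβ]; linear_combination (-1 / 4) * hs
  have hroots := KcK_roots ψ hψ a b ha hb α β h1 (by rw [h2, ZMod.card])
  have hbd : ∀ m : ℕ, 3 ≤ m → ‖α ^ (2 * m) + β ^ (2 * m)‖ ≤ 4 * (p : ℝ) * (p : ℝ) ^ m := by
    intro m hm
    have := KcK_bound p ψ hψ a b ha m hm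
    rwa [hroots _ (by omega), norm_neg] at this
  have hA := root_bound p hp1 α β (by rw [h2]; simp) hbd
  have hB := root_bound p hp1 β α (by rw [mul_comm, h2]; simp)
    (fun m hm => by rw [add_comm]; exact hbd m hm)
  have hA' := Real.le_sqrt_of_sq_le hA
  have hB' := Real.le_sqrt_of_sq_le hB
  have : KcK ψ a b 1 = -(α + β) := by rw [h1]; ring
  rw [this, norm_neg]
  refine (norm_add_le _ _).trans ?_
  linarith

end partA3

section partB

noncomputable def klR {R : Type*} [CommRing R] [Fintype Rˣ] (ψ : AddChar R ℂ) (a b : R) : ℂ :=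
  ∑ u : Rˣ, ψ (a * u + b * (u⁻¹ : Rˣ))

noncomputable def annC {R : Type*} [CommRing R] (a b : R) : ℕ :=
  Nat.card {t : R // t * a = 0 ∧ t * b = 0}

lemma klR_comm {R : Type*} [CommRing R] [Fintype Rˣ] (ψ : AddChar R ℂ) (a b : R) :
    klR ψ a b = klR ψ b a := by
  unfold klR
  rw [← Equiv.sum_comp (Equiv.inv Rˣ)]
  refine Finset.sum_congr rfl fun u _ => ?_
  simp [add_comm]

lemma annC_comm {R : Type*} [CommRing R] (a b : R) : annC a b = annC b a := by
  unfold annC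
  exact Nat.card_congr (Equiv.subtypeEquivRight fun t => and_comm)

lemma klR_trivial {R : Type*} [CommRing R] [Fintype R] [Fintype Rˣ] (ψ : AddChar R ℂ) (a b : R) :
    ‖klR ψ a b‖ ≤ Fintype.card R := by
  unfold klR
  refine (norm_sum_le _ _).trans ?_
  simp only [AddChar.norm_apply, Finset.sum_const, nsmul_eq_mul, mul_one, Finset.card_univ]
  exact_mod_cast Fintype.card_le_of_injective _ Units.val_injective

lemma klR_avg {R : Type*} [CommRing R] [Fintype R] [Fintype Rˣ] (ψ : AddChar R ℂ) (a b : R)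
    (φ : Rˣ → R → R) (h : ∀ t, klR ψ a b = ∑ u : Rˣ, ψ (a * u + b * (u⁻¹ : Rˣ)) * ψ (φ u t)) :
    Fintype.card R * ‖klR ψ a b‖ ≤ ∑ u : Rˣ, ‖∑ t, ψ (φ u t)‖ := by
  have h1 : (Fintype.card R : ℂ) * klR ψ a b =
      ∑ u : Rˣ, ψ (a * u + b * (u⁻¹ : Rˣ)) * ∑ t, ψ (φ u t) := by
    have : (Fintype.card R : ℂ) * klR ψ a b = ∑ _t : R, klR ψ a b := by
      simp [Finset.sum_const, Finset.card_univ]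
    rw [this, Finset.sum_congr rfl (fun t _ => h t), Finset.sum_comm]
    simp only [Finset.mul_sum]
  have h2 : (Fintype.card R : ℝ) * ‖klR ψ a b‖ = ‖(Fintype.card R : ℂ) * klR ψ a b‖ := by
    rw [norm_mul]; simp
  rw [h2, h1]
  refine (norm_sum_le _ _).trans (Finset.sum_le_sum fun u _ => ?_)
  rw [norm_mul, AddChar.norm_apply, one_mul]

lemma klR_shift {R : Type*} [CommRing R] [Fintype R] [Fintype Rˣ] (ψ : AddChar R ℂ) (a b s : R)
    (hu : ∀ t, IsUnit (1 + s * t)) (hs : s * s * s * b = 0) (t : R) :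
    klR ψ a b = ∑ u : Rˣ, ψ (a * u + b * (u⁻¹ : Rˣ)) *
      ψ (s * t * (a * u - b * (u⁻¹ : Rˣ)) + s * s * (t * t) * (b * (u⁻¹ : Rˣ))) := by
  obtain ⟨v, hv⟩ := hu t
  unfold klR
  rw [← Equiv.sum_comp (Equiv.mulRight v)]
  refine Finset.sum_congr rfl fun u _ => ?_
  rw [← AddChar.map_add_eq_mul]
  congr 1
  have hb : b * (v⁻¹ : Rˣ) = b * (1 - s * t + s * s * (t * t)) := by
    have h1 : b * (1 - s * t + s * s * (t * t)) * v = b := by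
      rw [hv]; linear_combination (t * t * t) * hs
    calc b * (v⁻¹ : Rˣ) = (b * (1 - s * t + s * s * (t * t)) * v) * (v⁻¹ : Rˣ) := by rw [h1]
      _ = _ := by rw [mul_assoc, Units.mul_inv, mul_one]
  simp only [Equiv.coe_mulRight, mul_inv_rev, Units.val_mul]
  rw [hv]
  linear_combination ((u⁻¹ : Rˣ) : R) * hb

open Classical in
lemma klR_count {R : Type*} [CommRing R] [Fintype R] [Fintype Rˣ] (ψ : AddChar R ℂ)
    (hψ : ψ.IsPrimitive) (a b s : R)
    (hu : ∀ t, IsUnit (1 + s * t)) (hs : s * s * b = 0) :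
    ‖klR ψ a b‖ ≤ (Finset.univ.filter (fun u : Rˣ => s * (a * u - b * (u⁻¹ : Rˣ)) = 0)).card := by
  have h := klR_avg ψ a b _ (klR_shift ψ a b s hu (by linear_combination s * hs))
  have hR : (0 : ℝ) < Fintype.card R := by exact_mod_cast Fintype.card_pos
  have h2 : ∀ u : Rˣ, ‖∑ t, ψ (s * t * (a * u - b * (u⁻¹ : Rˣ)) +
      s * s * (t * t) * (b * (u⁻¹ : Rˣ)))‖ =
      if s * (a * u - b * (u⁻¹ : Rˣ)) = 0 then (Fintype.card R : ℝ) else 0 := by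
    intro u
    have : ∀ t, s * t * (a * u - b * (u⁻¹ : Rˣ)) + s * s * (t * t) * (b * (u⁻¹ : Rˣ)) =
        t * (s * (a * u - b * (u⁻¹ : Rˣ))) := by
      intro t; linear_combination (t * t * (u⁻¹ : Rˣ)) * hs
    simp only [this]
    rw [AddChar.sum_mulShift _ hψ]
    split_ifs <;> simp
  rw [Finset.sum_congr rfl (fun u _ => h2 u), ← Finset.sum_filter, Finset.sum_const, nsmul_eq_mul,
    mul_comm] at h
  exact le_of_mul_le_mul_right h hR

section primepow
variable {p k : ℕ} [hp : Fact p.Prime]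

lemma pp_zero {n : ℕ} : ((p : ZMod (p ^ k)) ^ n = 0) ↔ k ≤ n := by
  rw [← Nat.cast_pow, ZMod.natCast_eq_zero_iff, Nat.pow_dvd_pow_iff_le_right hp.out.one_lt]

lemma pp_rep (x : ZMod (p ^ k)) : ∃ g ≤ k, ∃ w : (ZMod (p ^ k))ˣ, x = p ^ g * w := by
  have : NeZero (p ^ k) := ⟨pow_ne_zero _ hp.out.ne_zero⟩
  by_cases h0 : x = 0
  · exact ⟨k, le_rfl, 1, by rw [h0, pp_zero.2 le_rfl]; simp⟩
  have hv : x.val ≠ 0 := by rwa [Ne, ZMod.val_eq_zero]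
  obtain ⟨g, c, hc, he⟩ := Nat.exists_eq_pow_mul_and_not_dvd hv p hp.out.ne_one
  have hx : x = (p : ZMod (p ^ k)) ^ g * c := by
    conv_lhs => rw [← ZMod.natCast_zmod_val x, he]
    push_cast; ring
  have hcop : Nat.Coprime c (p ^ k) :=
    (((Nat.Prime.coprime_iff_not_dvd hp.out).2 hc).symm).pow_right k
  refine ⟨g, ?_, ZMod.unitOfCoprime c hcop, by rw [hx, ZMod.coe_unitOfCoprime]⟩
  by_contra hg
  apply h0
  rw [hx, pp_zero.2 (by omega), zero_mul]

lemma pp_mul_zero {n g : ℕ} (w : (ZMod (p ^ k))ˣ) :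
    ((p : ZMod (p ^ k)) ^ n * (p ^ g * w) = 0) ↔ k ≤ n + g := by
  rw [← mul_assoc, ← pow_add, Units.mul_left_eq_zero, pp_zero]

lemma pp_unit {l : ℕ} (hl : 1 ≤ l) (u : (ZMod (p ^ k))ˣ) (x : ZMod (p ^ k)) :
    IsUnit ((u : ZMod (p ^ k)) + p ^ l * x) := by
  have hn : IsNilpotent ((p : ZMod (p ^ k)) ^ l * x) := by
    refine ⟨k, ?_⟩
    rw [mul_pow, ← pow_mul, pp_zero.2 (by nlinarith), zero_mul]
  exact hn.isUnit_add_left_of_commute u.isUnit (Commute.all _ _)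

open Classical in
lemma pp_card (n : ℕ) (hn : 0 < n) [Fintype (ZMod (p ^ k))] :
    (Finset.univ.filter (fun z : ZMod (p ^ k) => (n : ZMod (p ^ k)) * z = 0)).card ≤ n := by
  have := IsAddCyclic.card_nsmul_eq_zero_le (α := ZMod (p ^ k)) hn
  simp only [nsmul_eq_mul] at this
  convert this

lemma pp_split {e : ℕ} (u v : (ZMod (p ^ k))ˣ)
    (h : (p : ZMod (p ^ k)) ^ e * (((u : ZMod (p ^ k)) - (v : ZMod (p ^ k))) * ((u : ZMod (p ^ k)) + (v : ZMod (p ^ k)))) = 0) :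
    (2 * p ^ e : ZMod (p ^ k)) * ((u : ZMod (p ^ k)) - (v : ZMod (p ^ k))) = 0 ∨ (2 * p ^ e : ZMod (p ^ k)) * ((u : ZMod (p ^ k)) + (v : ZMod (p ^ k))) = 0 := by
  obtain ⟨i, hi, w, hw⟩ := pp_rep ((u : ZMod (p ^ k)) - (v : ZMod (p ^ k)))
  obtain ⟨j, hj, w', hw'⟩ := pp_rep ((u : ZMod (p ^ k)) + (v : ZMod (p ^ k)))
  rw [hw, hw'] at h
  rcases le_total i j with hij | hij
  · right
    have h1 : (2 : ZMod (p ^ k)) * u = p ^ i * (w + p ^ (j - i) * w') := by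
      have : (p : ZMod (p ^ k)) ^ j = p ^ i * p ^ (j - i) := by rw [← pow_add]; congr 1; omega
      rw [this] at hw'
      linear_combination hw + hw'
    have h2 : (u : ZMod (p ^ k)) * (2 * p ^ e * ((u : ZMod (p ^ k)) + (v : ZMod (p ^ k)))) = 0 := by
      have : (u : ZMod (p ^ k)) * (2 * p ^ e * ((u : ZMod (p ^ k)) + (v : ZMod (p ^ k)))) = p ^ e * ((u : ZMod (p ^ k)) + (v : ZMod (p ^ k))) * (2 * u) := by ring
      rw [this, h1, hw']
      have h3 : (p : ZMod (p ^ k)) ^ e * p ^ i * p ^ j = 0 := by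
        have : (p : ZMod (p ^ k)) ^ e * p ^ i * p ^ j * (w * w' : (ZMod (p ^ k))ˣ) = 0 := by
          push_cast; linear_combination h
        rwa [Units.mul_left_eq_zero] at this
      linear_combination (w' * (w + p ^ (j - i) * w')) * h3
    rwa [Units.mul_right_eq_zero] at h2
  · left
    have h1 : (2 : ZMod (p ^ k)) * u = p ^ j * (w' + p ^ (i - j) * w) := by
      have : (p : ZMod (p ^ k)) ^ i = p ^ j * p ^ (i - j) := by rw [← pow_add]; congr 1; omega
      rw [this] at hw
      linear_combination hw + hw'
    have h2 : (u : ZMod (p ^ k)) * (2 * p ^ e * ((u : ZMod (p ^ k)) - (v : ZMod (p ^ k)))) = 0 := by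
      have : (u : ZMod (p ^ k)) * (2 * p ^ e * ((u : ZMod (p ^ k)) - (v : ZMod (p ^ k)))) = p ^ e * ((u : ZMod (p ^ k)) - (v : ZMod (p ^ k))) * (2 * u) := by ring
      rw [this, h1, hw]
      have h3 : (p : ZMod (p ^ k)) ^ e * p ^ i * p ^ j = 0 := by
        have : (p : ZMod (p ^ k)) ^ e * p ^ i * p ^ j * (w * w' : (ZMod (p ^ k))ˣ) = 0 := by
          push_cast; linear_combination h
        rwa [Units.mul_left_eq_zero] at this
      linear_combination (w * (w' + p ^ (i - j) * w)) * h3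
    rwa [Units.mul_right_eq_zero] at h2

open Classical in
lemma pp_count [Fintype (ZMod (p ^ k))ˣ] (e g : ℕ) (w : (ZMod (p ^ k))ˣ) (a b : ZMod (p ^ k))
    (ha : a = p ^ g * w) :
    (Finset.univ.filter (fun u : (ZMod (p ^ k))ˣ =>
      (p : ZMod (p ^ k)) ^ e * (a * u - b * (u⁻¹ : (ZMod (p ^ k))ˣ)) = 0)).card
      ≤ 4 * p ^ (e + g) := by
  have : NeZero (p ^ k) := ⟨pow_ne_zero _ hp.out.ne_zero⟩
  set S := Finset.univ.filter (fun u : (ZMod (p ^ k))ˣ =>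
      (p : ZMod (p ^ k)) ^ e * (a * u - b * (u⁻¹ : (ZMod (p ^ k))ˣ)) = 0) with hS
  rcases S.eq_empty_or_nonempty with h | ⟨v, hv⟩
  · rw [h]; simp
  set Z := Finset.univ.filter (fun z : ZMod (p ^ k) => ((2 * p ^ (e + g) : ℕ) : ZMod (p ^ k)) * z = 0)
    with hZ
  have hZc : Z.card ≤ 2 * p ^ (e + g) :=
    pp_card _ (Nat.mul_pos two_pos (pow_pos hp.out.pos _))
  have hsq : ∀ u ∈ S, (p : ZMod (p ^ k)) ^ e * (a * (u * u)) = p ^ e * b := by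
    intro u hu
    have h1 := (Finset.mem_filter.1 hu).2
    have h2 : (u : ZMod (p ^ k)) * (u⁻¹ : (ZMod (p ^ k))ˣ) = 1 := Units.mul_inv u
    linear_combination (u : ZMod (p ^ k)) * h1 + p ^ e * b * h2
  have hsub : S.image (Units.val) ⊆
      Z.image (fun z => z + v) ∪ Z.image (fun z => z - v) := by
    intro x hx
    obtain ⟨u, hu, rfl⟩ := Finset.mem_image.1 hx
    have h1 := hsq u hu
    have h2 := hsq v hv
    have h3 : (p : ZMod (p ^ k)) ^ (e + g) * (((u : ZMod (p ^ k)) - (v : ZMod (p ^ k))) * ((u : ZMod (p ^ k)) + (v : ZMod (p ^ k)))) = 0 := by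
      have : (p : ZMod (p ^ k)) ^ (e + g) * (((u : ZMod (p ^ k)) - (v : ZMod (p ^ k))) * ((u : ZMod (p ^ k)) + (v : ZMod (p ^ k)))) * w = 0 := by
        rw [ha] at h1 h2
        rw [pow_add]
        linear_combination h1 - h2
      rwa [Units.mul_left_eq_zero] at this
    rw [Finset.mem_union]
    rcases pp_split u v h3 with h4 | h4
    · left
      exact Finset.mem_image.2 ⟨u - v, Finset.mem_filter.2 ⟨Finset.mem_univ _, by
        push_cast; exact h4⟩, by ring⟩
    · right
      exact Finset.mem_image.2 ⟨u + v, Finset.mem_filter.2 ⟨Finset.mem_univ _, by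
        push_cast; exact h4⟩, by ring⟩
  rw [← Finset.card_image_of_injective S Units.val_injective]
  refine (Finset.card_le_card hsub).trans ((Finset.card_union_le _ _).trans ?_)
  have h1 := Finset.card_image_le (s := Z) (f := fun z => z + (v : ZMod (p ^ k)))
  have h2 := Finset.card_image_le (s := Z) (f := fun z => z - (v : ZMod (p ^ k)))
  omega

lemma pp_ann (g : ℕ) (hg : g ≤ k) (a b : ZMod (p ^ k)) (x y : ZMod (p ^ k))
    (ha : a = p ^ g * x) (hb : b = p ^ g * y) : p ^ g ≤ annC a b := by
  have : NeZero (p ^ k) := ⟨pow_ne_zero _ hp.out.ne_zero⟩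
  unfold annC
  have hz : (p : ZMod (p ^ k)) ^ (k - g) * p ^ g = 0 := by
    rw [← pow_add, pp_zero]; omega
  let f : Fin (p ^ g) → {t : ZMod (p ^ k) // t * a = 0 ∧ t * b = 0} := fun j =>
    ⟨((p ^ (k - g) * (j : ℕ) : ℕ) : ZMod (p ^ k)), by
      push_cast
      constructor
      · rw [ha]; linear_combination (j : ZMod (p ^ k)) * x * hz
      · rw [hb]; linear_combination (j : ZMod (p ^ k)) * y * hz⟩
  have hf : Function.Injective f := by
    intro i j hij
    have h1 : ((p ^ (k - g) * (i : ℕ) : ℕ) : ZMod (p ^ k)) = ((p ^ (k - g) * (j : ℕ) : ℕ) : ZMod _) :=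
      congrArg Subtype.val hij
    have hlt : ∀ i : Fin (p ^ g), p ^ (k - g) * (i : ℕ) < p ^ k := by
      intro i
      calc p ^ (k - g) * (i : ℕ) < p ^ (k - g) * p ^ g :=
            Nat.mul_lt_mul_of_pos_left i.2 (pow_pos hp.out.pos _)
        _ = p ^ k := by rw [← pow_add]; congr 1; omega
    rw [ZMod.natCast_eq_natCast_iff', Nat.mod_eq_of_lt (hlt i), Nat.mod_eq_of_lt (hlt j)] at h1
    exact Fin.ext (Nat.eq_of_mul_eq_mul_left (pow_pos hp.out.pos _) h1)
  have := Nat.card_le_card_of_injective f hf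
  simpa using this

end primepow

lemma gauss_bound {R : Type*} [CommRing R] [Fintype R] [DecidableEq R] (ψ : AddChar R ℂ)
    (hψ : ψ.IsPrimitive) (A B : R) :
    ‖∑ t : R, ψ (t * A + t * t * B)‖ ^ 2 ≤
      Fintype.card R * (Finset.univ.filter (fun h : R => 2 * B * h = 0)).card := by
  set G := ∑ t : R, ψ (t * A + t * t * B) with hG
  have h1 : ((‖G‖ ^ 2 : ℝ) : ℂ) = ∑ h : R, ψ (h * A + h * h * B) * ∑ t : R, ψ (t * (2 * B * h)) := by
    have hc : ((‖G‖ ^ 2 : ℝ) : ℂ) = G * (starRingEnd ℂ) G := by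
      rw [Complex.mul_conj, Complex.normSq_eq_norm_sq]
    have hc2 : (starRingEnd ℂ) G = ∑ t : R, ψ (-(t * A + t * t * B)) := by
      rw [hG, map_sum]
      refine Finset.sum_congr rfl fun t _ => ?_
      rw [AddChar.map_neg_eq_conj]
    rw [hc, hc2, hG, Finset.sum_mul_sum, Finset.sum_comm]
    simp only [Finset.mul_sum]
    conv_rhs => rw [Finset.sum_comm]
    refine Finset.sum_congr rfl fun t _ => ?_
    rw [← Equiv.sum_comp (Equiv.addRight t)]
    refine Finset.sum_congr rfl fun h _ => ?_
    rw [← AddChar.map_add_eq_mul, ← AddChar.map_add_eq_mul]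
    congr 1
    simp only [Equiv.coe_addRight]
    ring
  have h2 : ‖G‖ ^ 2 = ‖((‖G‖ ^ 2 : ℝ) : ℂ)‖ := by
    rw [Complex.norm_real, Real.norm_of_nonneg (by positivity)]
  rw [h2, h1]
  refine (norm_sum_le _ _).trans ?_
  have h3 : ∀ h : R, ‖ψ (h * A + h * h * B) * ∑ t : R, ψ (t * (2 * B * h))‖ =
      if 2 * B * h = 0 then (Fintype.card R : ℝ) else 0 := by
    intro h
    rw [norm_mul, AddChar.norm_apply, one_mul, AddChar.sum_mulShift _ hψ]
    split_ifs <;> simp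
  rw [Finset.sum_congr rfl (fun h _ => h3 h), ← Finset.sum_filter, Finset.sum_const, nsmul_eq_mul,
    mul_comm]

end partB

section partB2

section primepow2
variable {p k : ℕ} [hp : Fact p.Prime]

open Classical in
lemma pp_case3 (ψ : AddChar (ZMod (p ^ k)) ℂ) (hψ : ψ.IsPrimitive) (l g : ℕ) (hl : 1 ≤ l)
    (hk : k ≤ 2 * l + g) (a b y : ZMod (p ^ k)) (w : (ZMod (p ^ k))ˣ) (ha : a = p ^ g * w)
    (hb : b = p ^ g * y) : ‖klR ψ a b‖ ≤ 4 * (p : ℝ) ^ (l + g) := by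
  have h := klR_count ψ hψ a b ((p : ZMod (p ^ k)) ^ l)
    (fun t => by simpa using pp_unit hl 1 t) (by
      have h0 : (p : ZMod (p ^ k)) ^ (2 * l + g) = 0 := pp_zero.2 hk
      rw [hb]
      linear_combination y * h0)
  refine h.trans ?_
  have h2 := pp_count l g w a b ha
  refine le_trans ?_ (show ((4 * p ^ (l + g) : ℕ) : ℝ) ≤ _ by push_cast; rfl)
  exact_mod_cast h2

open Classical in
lemma pp_case4 (ψ : AddChar (ZMod (p ^ k)) ℂ) (hψ : ψ.IsPrimitive) (l : ℕ) (hl : 1 ≤ l)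
    (hk : k = 2 * l + 1) (a b : ZMod (p ^ k)) (w : (ZMod (p ^ k))ˣ) (ha : a = w) :
    ‖klR ψ a b‖ ≤ 8 * √((p : ℝ) ^ k) := by
  have hz : ∀ n, k ≤ n → (p : ZMod (p ^ k)) ^ n = 0 := fun n hn => pp_zero.2 hn
  have h := klR_avg ψ a b _ (klR_shift ψ a b ((p : ZMod (p ^ k)) ^ l)
    (fun t => by simpa using pp_unit hl 1 t) (by
      linear_combination b * hz (3 * l) (by omega)))
  have hpp : (0 : ℝ) < p := by exact_mod_cast hp.out.pos
  have hG : ∀ u : (ZMod (p ^ k))ˣ,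
      ‖∑ t, ψ ((p : ZMod (p ^ k)) ^ l * t * (a * u - b * (u⁻¹ : (ZMod (p ^ k))ˣ)) +
        (p : ZMod (p ^ k)) ^ l * (p : ZMod (p ^ k)) ^ l * (t * t) * (b * (u⁻¹ : (ZMod (p ^ k))ˣ)))‖ ≤
      if (p : ZMod (p ^ k)) ^ (l + 1) * (a * u - b * (u⁻¹ : (ZMod (p ^ k))ˣ)) = 0 then
        2 * (p : ℝ) ^ l * √((p : ℝ) ^ k) else 0 := by
    intro u
    set A := a * u - b * (u⁻¹ : (ZMod (p ^ k))ˣ) with hA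
    set B := b * (u⁻¹ : (ZMod (p ^ k))ˣ) with hB
    split_ifs with hc
    · obtain ⟨i, hi, w', hw'⟩ := pp_rep A
      rw [hw', pp_mul_zero] at hc
      have hBu : IsUnit B := by
        have : B = ((w * u : (ZMod (p ^ k))ˣ) : ZMod (p ^ k)) + p ^ i * (-w') := by
          push_cast
          rw [← ha]
          linear_combination hA - hw'
        rw [this]
        exact pp_unit (by omega) _ _
      have hg := gauss_bound ψ hψ (p ^ l * A) (p ^ l * p ^ l * B)
      have he : ∀ t : ZMod (p ^ k), t * (p ^ l * A) + t * t * (p ^ l * p ^ l * B) =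
        p ^ l * t * A + p ^ l * p ^ l * (t * t) * B := by intro t; ring
      simp only [he] at hg
      have hcard : (Finset.univ.filter
          (fun h : ZMod (p ^ k) => 2 * (p ^ l * p ^ l * B) * h = 0)).card ≤ 2 * p ^ (2 * l) := by
        refine le_trans (Finset.card_le_card ?_)
          (pp_card (p := p) (k := k) (2 * p ^ (2 * l)) (by have := hp.out.pos; positivity))
        intro x hx
        simp only [Finset.mem_filter, Finset.mem_univ, true_and] at hx ⊢
        push_cast
        have : B * (2 * p ^ (2 * l) * x) = 0 := by rw [← hx]; ring
        rwa [hBu.mul_right_eq_zero] at this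
      have hcard' : (((Finset.univ.filter
          (fun h : ZMod (p ^ k) => 2 * (p ^ l * p ^ l * B) * h = 0)).card : ℕ) : ℝ)
          ≤ 2 * (p : ℝ) ^ (2 * l) := by exact_mod_cast hcard
      refine abs_le_of_sq_le_sq' ?_ (by positivity) |>.2
      refine hg.trans ?_
      rw [ZMod.card]
      rw [mul_pow, mul_pow, Real.sq_sqrt (by positivity)]
      push_cast
      have h1 : (0 : ℝ) < (p : ℝ) ^ k := by positivity
      have h2 : (0 : ℝ) < (p : ℝ) ^ (2 * l) := by positivity
      have h3 : ((p : ℝ) ^ l) ^ 2 = (p : ℝ) ^ (2 * l) := by ring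
      rw [h3]
      calc (p : ℝ) ^ k * _ ≤ (p : ℝ) ^ k * (2 * (p : ℝ) ^ (2 * l)) := by gcongr
        _ ≤ _ := by nlinarith [mul_pos h1 h2]
    · have hne := hψ hc
      obtain ⟨z, hz'⟩ : ∃ z, ψ (p ^ (l + 1) * A * z) ≠ 1 := by
        by_contra hcon
        push Not at hcon
        apply hne
        ext z
        simp [AddChar.mulShift_apply, hcon z]
      have hsum : (∑ t, ψ ((p : ZMod (p ^ k)) ^ l * t * A + p ^ l * p ^ l * (t * t) * B)) =
          ψ (p ^ (l + 1) * A * z) *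
          ∑ t, ψ ((p : ZMod (p ^ k)) ^ l * t * A + p ^ l * p ^ l * (t * t) * B) := by
        conv_lhs => rw [← Equiv.sum_comp (Equiv.addRight ((p : ZMod (p ^ k)) * z))]
        rw [Finset.mul_sum]
        refine Finset.sum_congr rfl fun t _ => ?_
        rw [← AddChar.map_add_eq_mul]
        congr 1
        simp only [Equiv.coe_addRight]
        have h0 := hz (2 * l + 1) (by omega)
        linear_combination (2 * t * z + p * z * z) * B * h0
      have : (∑ t, ψ ((p : ZMod (p ^ k)) ^ l * t * A + p ^ l * p ^ l * (t * t) * B)) = 0 := by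
        have h1 : (1 - ψ (p ^ (l + 1) * A * z)) *
          (∑ t, ψ ((p : ZMod (p ^ k)) ^ l * t * A + p ^ l * p ^ l * (t * t) * B)) = 0 := by
          linear_combination hsum
        rcases mul_eq_zero.1 h1 with h2 | h2
        · exact absurd (sub_eq_zero.1 h2).symm hz'
        · exact h2
      rw [this, norm_zero]
  have h2 := h.trans (Finset.sum_le_sum fun u _ => hG u)
  rw [← Finset.sum_filter, Finset.sum_const, nsmul_eq_mul] at h2
  have h3 := pp_count (l + 1) 0 w a b (by simp [ha])
  have h3' : (((Finset.univ.filter (fun u : (ZMod (p ^ k))ˣ =>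
      (p : ZMod (p ^ k)) ^ (l + 1) * (a * u - b * (u⁻¹ : (ZMod (p ^ k))ˣ)) = 0)).card : ℕ) : ℝ)
      ≤ 4 * (p : ℝ) ^ (l + 1) := by exact_mod_cast h3
  rw [ZMod.card] at h2
  push_cast at h2
  have h4 : (0 : ℝ) < (p : ℝ) ^ k := by positivity
  refine le_of_mul_le_mul_left (h2.trans ?_) h4
  calc _ ≤ 4 * (p : ℝ) ^ (l + 1) * (2 * (p : ℝ) ^ l * √((p : ℝ) ^ k)) := by gcongr
    _ = 8 * (p : ℝ) ^ (2 * l + 1) * √((p : ℝ) ^ k) := by ring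
    _ = _ := by rw [← hk]; ring

lemma klR_prime {m : ℕ} [NeZero m] (hm : m = p) (ψ : AddChar (ZMod m) ℂ) (hψ : ψ.IsPrimitive)
    (a b : ZMod m) (ha : a ≠ 0) : ‖klR ψ a b‖ ≤ 8 * √(m : ℝ) := by
  subst hm
  have h1 : ψ ≠ 1 := by
    have := hψ (one_ne_zero (α := ZMod m))
    simpa using this
  have hm1 : (1 : ℝ) ≤ √(m : ℝ) := by
    rw [Real.one_le_sqrt]; exact_mod_cast hp.out.one_lt.le
  by_cases hb : b = 0
  · subst hb
    unfold klR
    have h2 : ∑ x : ZMod m, ψ (x * a) = 0 := by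
      rw [AddChar.sum_mulShift _ hψ, if_neg ha]; simp
    have h3 : ∑ u : (ZMod m)ˣ, ψ (a * u + 0 * (u⁻¹ : (ZMod m)ˣ)) = -1 := by
      have h4 : ∑ u : (ZMod m)ˣ, ψ (a * u + 0 * (u⁻¹ : (ZMod m)ˣ)) =
          ∑ x ∈ Finset.univ.erase (0 : ZMod m), ψ (x * a) := by
        refine Finset.sum_bij (fun u _ => (u : ZMod m)) ?_ ?_ ?_ ?_
        · intro u _; simp
        · intro u _ v _ h; exact Units.ext h
        · intro x hx
          exact ⟨Units.mk0 x (Finset.ne_of_mem_erase hx), Finset.mem_univ _, rfl⟩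
        · intro u _; congr 1; ring
      rw [h4]
      have := Finset.add_sum_erase Finset.univ (fun x : ZMod m => ψ (x * a)) (Finset.mem_univ 0)
      rw [h2] at this
      simp only [zero_mul, AddChar.map_zero_eq_one] at this
      linear_combination this
    rw [h3, norm_neg, norm_one]
    linarith
  · have := weil_kloosterman m ψ h1 a b ha hb
    unfold klR
    refine le_trans ?_ (this.trans ?_)
    · apply le_of_eq; congr!
    · linarith

theorem klR_pp_aux (hk : 1 ≤ k) (ψ : AddChar (ZMod (p ^ k)) ℂ) (hψ : ψ.IsPrimitive)
    (a b y : ZMod (p ^ k)) (g : ℕ) (hg : g ≤ k) (w : (ZMod (p ^ k))ˣ) (ha : a = p ^ g * w)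
    (hb : b = p ^ g * y) :
    ‖klR ψ a b‖ ≤ 8 * √((p ^ k : ℕ) : ℝ) * annC a b := by
  have hpp : (0 : ℝ) < p := by exact_mod_cast hp.out.pos
  have hp1 : (1 : ℝ) ≤ p := by exact_mod_cast hp.out.one_lt.le
  have hann : (p : ℝ) ^ g ≤ annC a b := by exact_mod_cast pp_ann g hg a b _ _ ha hb
  refine le_trans ?_ (mul_le_mul_of_nonneg_left hann (by positivity))
  push_cast
  have hs1 : 1 ≤ √((p : ℝ) ^ k) := by rw [Real.one_le_sqrt]; exact one_le_pow₀ hp1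
  have hpg : 1 ≤ (p : ℝ) ^ g := one_le_pow₀ hp1
  rcases hg.eq_or_lt with rfl | hlt
  · refine (klR_trivial ψ a b).trans ?_
    rw [ZMod.card]; push_cast
    nlinarith [mul_le_mul_of_nonneg_right hs1 (by linarith : 0 ≤ (p : ℝ) ^ g)]
  have key : ∀ l, 1 ≤ l → k ≤ 2 * l + g → 2 * l ≤ k → 
      ‖klR ψ a b‖ ≤ 8 * √((p : ℝ) ^ k) * (p : ℝ) ^ g := by
    intro l h1 h2 h3
    refine (pp_case3 ψ hψ l g h1 h2 a b y w ha hb).trans ?_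
    have h4 : (p : ℝ) ^ l ≤ √((p : ℝ) ^ k) := by
      apply Real.le_sqrt_of_sq_le
      rw [← pow_mul]
      exact pow_le_pow_right₀ hp1 (by omega)
    rw [pow_add, ← mul_assoc]
    refine mul_le_mul_of_nonneg_right ?_ (by positivity)
    linarith
  by_cases hc : (k - g) % 2 = 0 ∨ 1 ≤ g
  · exact key ((k - g + 1) / 2) (by omega) (by omega) (by omega)
  have hg0 : g = 0 := by omega
  subst hg0
  simp only [pow_zero, one_mul, mul_one] at *
  rcases hk.eq_or_lt with hk1 | hk2
  · have hm : p ^ k = p := by rw [← hk1, pow_one]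
    have : Nontrivial (ZMod (p ^ k)) := by
      rw [hm]; infer_instance
    have := klR_prime hm ψ hψ a b (by rw [ha]; exact w.ne_zero)
    push_cast at this
    exact this
  · exact pp_case4 ψ hψ (k / 2) (by omega) (by omega) a b w ha

theorem klR_pp (hk : 1 ≤ k) (ψ : AddChar (ZMod (p ^ k)) ℂ) (hψ : ψ.IsPrimitive)
    (a b : ZMod (p ^ k)) :
    ‖klR ψ a b‖ ≤ 8 * √((p ^ k : ℕ) : ℝ) * annC a b := by
  obtain ⟨g, hg, w, ha⟩ := pp_rep a
  obtain ⟨h, hh, v, hb⟩ := pp_rep b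
  rcases le_total g h with hgh | hgh
  · refine klR_pp_aux hk ψ hψ a b (p ^ (h - g) * v) g hg w ha ?_
    rw [hb, ← mul_assoc, ← pow_add, Nat.add_sub_cancel' hgh]
  · rw [klR_comm, annC_comm]
    refine klR_pp_aux hk ψ hψ b a (p ^ (g - h) * w) h hh v hb ?_
    rw [ha, ← mul_assoc, ← pow_add, Nat.add_sub_cancel' hgh]

end primepow2

end partB2

section partC

section crt
variable {R S T : Type*} [CommRing R] [CommRing S] [CommRing T]

def psiL (e : R ≃+* S × T) (ψ : AddChar R ℂ) : AddChar S ℂ :=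
  ψ.compAddMonoidHom ((e.symm : S × T →+ R).comp (AddMonoidHom.inl S T))

def psiR (e : R ≃+* S × T) (ψ : AddChar R ℂ) : AddChar T ℂ :=
  ψ.compAddMonoidHom ((e.symm : S × T →+ R).comp (AddMonoidHom.inr S T))

lemma psi_split (e : R ≃+* S × T) (ψ : AddChar R ℂ) (s : S) (t : T) :
    ψ (e.symm (s, t)) = psiL e ψ s * psiR e ψ t := by
  have : ((s, t) : S × T) = (s, 0) + (0, t) := by simp
  rw [this, map_add, AddChar.map_add_eq_mul]
  rfl

lemma psiL_prim (e : R ≃+* S × T) (ψ : AddChar R ℂ) (h : ψ.IsPrimitive) :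
    (psiL e ψ).IsPrimitive := by
  intro s hs hcon
  refine h (a := e.symm (s, 0)) (by simpa using hs) ?_
  ext x
  have h1 : e.symm (s, 0) * x = e.symm (s * (e x).1, 0) := by
    apply e.injective; rw [map_mul]; simp [Prod.ext_iff]
  have h2 := DFunLike.congr_fun hcon (e x).1
  simp only [AddChar.mulShift_apply, AddChar.one_apply] at h2 ⊢
  rw [h1]; exact h2

lemma psiR_prim (e : R ≃+* S × T) (ψ : AddChar R ℂ) (h : ψ.IsPrimitive) :
    (psiR e ψ).IsPrimitive := by
  intro s hs hcon
  refine h (a := e.symm (0, s)) (by simpa using hs) ?_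
  ext x
  have h1 : e.symm (0, s) * x = e.symm (0, s * (e x).2) := by
    apply e.injective; rw [map_mul]; simp [Prod.ext_iff]
  have h2 := DFunLike.congr_fun hcon (e x).2
  simp only [AddChar.mulShift_apply, AddChar.one_apply] at h2 ⊢
  rw [h1]; exact h2

lemma klR_mul [Fintype Rˣ] [Fintype Sˣ] [Fintype Tˣ] (e : R ≃+* S × T) (ψ : AddChar R ℂ) (a b : R) :
    klR ψ a b = klR (psiL e ψ) (e a).1 (e b).1 * klR (psiR e ψ) (e a).2 (e b).2 := by
  unfold klR
  rw [Fintype.sum_mul_sum, ← Fintype.sum_prod_type']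
  refine Fintype.sum_equiv ((Units.mapEquiv e.toMulEquiv).trans MulEquiv.prodUnits).toEquiv _ _ ?_
  intro u
  rw [← psi_split]
  congr 1
  apply e.injective
  simp only [map_add, map_mul, RingEquiv.apply_symm_apply]
  ext <;> simp [MulEquiv.prodUnits] <;> rfl

lemma annC_mul [Finite R] (e : R ≃+* S × T) (a b : R) :
    annC a b = annC (e a).1 (e b).1 * annC (e a).2 (e b).2 := by
  unfold annC
  rw [← Nat.card_prod]
  refine Nat.card_congr ?_
  refine (e.toEquiv.subtypeEquiv (q := fun x : S × T =>
    (x.1 * (e a).1 = 0 ∧ x.1 * (e b).1 = 0) ∧ (x.2 * (e a).2 = 0 ∧ x.2 * (e b).2 = 0)) ?_).trans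
    (Equiv.subtypeProdEquivProd (p := fun x : S => x * (e a).1 = 0 ∧ x * (e b).1 = 0)
      (q := fun x : T => x * (e a).2 = 0 ∧ x * (e b).2 = 0))
  intro t
  rw [← e.map_eq_zero_iff, ← e.map_eq_zero_iff (x := t * b), map_mul, map_mul, Prod.ext_iff,
    Prod.ext_iff]
  simp
  tauto
end crt

theorem klR_bound (m : ℕ) : ∀ [NeZero m] (ψ : AddChar (ZMod m) ℂ) (_ : ψ.IsPrimitive) 
    (a b : ZMod m), ‖klR ψ a b‖ ≤ 8 ^ m.primeFactors.card * √(m : ℝ) * annC a b := by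
  induction m using Nat.recOnPosPrimePosCoprime with
  | zero => intro h; exact absurd rfl h.out
  | one =>
    intro _ ψ _ a b
    refine (klR_trivial ψ a b).trans ?_
    have : annC a b = 1 := by
      unfold annC
      rw [Nat.card_eq_one_iff_unique]
      exact ⟨inferInstance, ⟨0, by simp, by simp⟩⟩
    rw [this]; simp
  | prime_pow p n hp hn =>
    intro _ ψ hψ a b
    have : Fact p.Prime := ⟨hp⟩
    have h := klR_pp hn ψ hψ a b
    rw [Nat.primeFactors_prime_pow (by omega) hp]
    simpa using h
  | coprime a b ha hb hab iha ihb =>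
    intro _ ψ hψ x y
    have : NeZero a := ⟨by omega⟩
    have : NeZero b := ⟨by omega⟩
    rw [klR_mul (ZMod.chineseRemainder hab) ψ x y, annC_mul (ZMod.chineseRemainder hab) x y, norm_mul,
      Nat.Coprime.primeFactors_mul hab, Finset.card_union_of_disjoint hab.disjoint_primeFactors]
    have h1 := iha _ (psiL_prim (ZMod.chineseRemainder hab) ψ hψ)
      (ZMod.chineseRemainder hab x).1 (ZMod.chineseRemainder hab y).1
    have h2 := ihb _ (psiR_prim (ZMod.chineseRemainder hab) ψ hψ)
      (ZMod.chineseRemainder hab x).2 (ZMod.chineseRemainder hab y).2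
    refine (mul_le_mul h1 h2 (norm_nonneg _) (by positivity)).trans (le_of_eq ?_)
    push_cast
    rw [Real.sqrt_mul (by positivity)]
    ring

end partC

section partD

lemma div_pp (ε : ℝ) (hε : 0 < ε) : ∃ B : ℝ, 1 ≤ B ∧ ∀ p k : ℕ, 2 ≤ p →
    ((k + 1 : ℕ) : ℝ) ≤ (if (p : ℝ) ^ ε < 2 then B else 1) * ((p : ℝ) ^ ε) ^ k := by
  have hc : (1 : ℝ) < (2 : ℝ) ^ ε := Real.one_lt_rpow (by norm_num) hε
  set d := (2 : ℝ) ^ ε - 1 with hd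
  have hd0 : 0 < d := by linarith
  refine ⟨1 + 1 / d, by have := one_div_pos.2 hd0; linarith, fun p k hp => ?_⟩
  have hp2 : (2 : ℝ) ^ ε ≤ (p : ℝ) ^ ε :=
    Real.rpow_le_rpow (by norm_num) (by exact_mod_cast hp) hε.le
  split_ifs with h
  · have h1 : (1 + k * d : ℝ) ≤ ((p : ℝ) ^ ε) ^ k := by
      have := one_add_mul_le_pow (a := d) (by linarith) k
      refine this.trans ?_
      have : 1 + d = (2 : ℝ) ^ ε := by rw [hd]; ring
      rw [this]
      gcongr
    have hb := one_div_pos.2 hd0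
    refine le_trans ?_ (mul_le_mul_of_nonneg_left h1 (by linarith))
    have h2 : 1 / d * d = 1 := by field_simp
    have hk : (0 : ℝ) ≤ k := by positivity
    push_cast
    nlinarith [mul_nonneg hk hd0.le]
  · push Not at h
    rw [one_mul]
    have h1 : ((2 : ℝ)) ^ k ≤ ((p : ℝ) ^ ε) ^ k := by gcongr
    refine le_trans ?_ h1
    have : k + 1 ≤ 2 ^ k := Nat.lt_two_pow_self
    exact_mod_cast this

lemma div_bound (ε : ℝ) (hε : 0 < ε) : ∃ C : ℝ, 1 ≤ C ∧ ∀ m : ℕ, 0 < m →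
    (m.divisors.card : ℝ) ≤ C * (m : ℝ) ^ ε := by
  obtain ⟨B, hB, h⟩ := div_pp ε hε
  obtain ⟨N, hN⟩ := exists_nat_ge ((2 : ℝ) ^ (1 / ε))
  refine ⟨B ^ N, one_le_pow₀ hB, fun m hm => ?_⟩
  rw [Nat.card_divisors hm.ne']
  have h1 : (m : ℝ) ^ ε = ∏ p ∈ m.primeFactors, ((p : ℝ) ^ ε) ^ (m.factorization p) := by
    conv_lhs => rw [← Nat.prod_factorization_pow_eq_self hm.ne']
    rw [Finsupp.prod, Nat.support_factorization]
    push_cast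
    rw [← Real.finsetProd_rpow _ _ (fun i _ => by positivity)]
    refine Finset.prod_congr rfl fun p _ => ?_
    rw [← Real.rpow_natCast, ← Real.rpow_natCast, ← Real.rpow_mul (by positivity), ← Real.rpow_mul (by positivity), mul_comm]
  rw [h1]
  push_cast
  calc ∏ x ∈ m.primeFactors, ((m.factorization x : ℝ) + 1)
      ≤ ∏ x ∈ m.primeFactors, ((if (x : ℝ) ^ ε < 2 then B else 1) * ((x : ℝ) ^ ε) ^ (m.factorization x)) := by
        refine Finset.prod_le_prod (fun _ _ => by positivity) fun x hx => ?_
        have := h x (m.factorization x) (Nat.prime_of_mem_primeFactors hx).two_le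
        exact_mod_cast this
    _ = (∏ x ∈ m.primeFactors, (if (x : ℝ) ^ ε < 2 then B else 1)) * _ := Finset.prod_mul_distrib
    _ ≤ _ := by
      refine mul_le_mul_of_nonneg_right ?_ (Finset.prod_nonneg fun _ _ => by positivity)
      rw [← Finset.prod_filter, Finset.prod_const]
      refine pow_le_pow_right₀ hB ?_
      have hsub : m.primeFactors.filter (fun x : ℕ => (x : ℝ) ^ ε < 2) ⊆ Finset.range N := by
        intro x hx
        rw [Finset.mem_filter] at hx
        rw [Finset.mem_range]
        by_contra hcon
        push Not at hcon
        have h3 : (2 : ℝ) ^ (1 / ε) ≤ x := hN.trans (by exact_mod_cast hcon)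
        have h4 := Real.rpow_le_rpow (by positivity) h3 hε.le
        rw [← Real.rpow_mul (by norm_num), one_div_mul_cancel hε.ne', Real.rpow_one] at h4
        linarith [hx.2]
      simpa using Finset.card_le_card hsub

lemma two_pow_omega (m : ℕ) (hm : 0 < m) : 2 ^ m.primeFactors.card ≤ m.divisors.card := by
  rw [Nat.card_divisors hm.ne', ← Finset.prod_const]
  refine Finset.prod_le_prod' fun p hp => ?_
  have : 1 ≤ m.factorization p :=
    (Nat.prime_of_mem_primeFactors hp).factorization_pos_of_dvd hm.ne' (Nat.dvd_of_mem_primeFactors hp)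
  omega

/-- combined constant: `8^ω (τ (1+log m))^2 ≤ C m^ε`. -/
lemma all_const (ε : ℝ) (hε : 0 < ε) : ∃ C : ℝ, 1 ≤ C ∧ ∀ m : ℕ, 0 < m →
    (8 : ℝ) ^ m.primeFactors.card * (m.divisors.card * (1 + Real.log m)) * (1 + Real.log m) ≤ C * (m : ℝ) ^ ε := by
  set δ := ε / 6 with hδ
  have hδ0 : 0 < δ := by positivity
  obtain ⟨D, hD, h⟩ := div_bound δ hδ0
  have hE1 : 1 ≤ 1 + 1 / δ := by have := one_div_pos.2 hδ0; linarith
  refine ⟨D ^ 4 * (1 + 1 / δ) ^ 2, by nlinarith [one_le_pow₀ hD (n := 4), one_le_pow₀ hE1 (n := 2)], fun m hm => ?_⟩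
  have hm1 : (1 : ℝ) ≤ m := by exact_mod_cast hm
  have hx1 : 1 ≤ (m : ℝ) ^ δ := Real.one_le_rpow hm1 hδ0.le
  have hx : (m : ℝ) ^ ε = ((m : ℝ) ^ δ) ^ 6 := by
    rw [← Real.rpow_natCast, ← Real.rpow_mul (by positivity)]; congr 1; rw [hδ]; push_cast; ring
  have hlog0 : 0 ≤ Real.log m := Real.log_nonneg hm1
  have hlog : 1 + Real.log m ≤ (1 + 1 / δ) * (m : ℝ) ^ δ := by
    have := Real.log_le_rpow_div (by positivity : (0 : ℝ) ≤ m) hδ0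
    have h2 : (1 + 1 / δ) * (m : ℝ) ^ δ = (m : ℝ) ^ δ + (m : ℝ) ^ δ / δ := by ring
    rw [h2]; linarith
  have ht := h m hm
  have h8 : (8 : ℝ) ^ m.primeFactors.card ≤ (m.divisors.card : ℝ) ^ 3 := by
    have h9 : ((2 : ℝ) ^ m.primeFactors.card) ≤ m.divisors.card := by exact_mod_cast two_pow_omega m hm
    calc (8 : ℝ) ^ m.primeFactors.card = ((2 : ℝ) ^ m.primeFactors.card) ^ 3 := by
          rw [← pow_mul, mul_comm, pow_mul]; norm_num
      _ ≤ _ := by gcongr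
  calc _ ≤ (D * (m : ℝ) ^ δ) ^ 3 * ((D * (m : ℝ) ^ δ) * ((1 + 1 / δ) * (m : ℝ) ^ δ)) * ((1 + 1 / δ) * (m : ℝ) ^ δ) := by
        gcongr
        exact h8.trans (by gcongr)
    _ = _ := by rw [hx]; ring

end partD

section partE1

noncomputable def wgt (m : ℕ) (h : ZMod m) : ℝ :=
  (m : ℝ) / 2 * (1 / (h.val : ℝ) + 1 / ((m - h.val : ℕ) : ℝ))

lemma wgt_nonneg (m : ℕ) (h : ZMod m) : 0 ≤ wgt m h := by unfold wgt; positivity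

lemma std_norm_sub (m : ℕ) [NeZero m] (h : ZMod m) :
    ‖ZMod.stdAddChar h - 1‖ = 2 * |Real.sin (Real.pi * h.val / m)| := by
  have h1 : (ZMod.stdAddChar h : ℂ) =
      Complex.exp (Complex.I * ((2 * Real.pi * h.val / m : ℝ) : ℂ)) := by
    conv_lhs => rw [← ZMod.natCast_zmod_val h]
    have := ZMod.stdAddChar_coe (N := m) (h.val : ℤ)
    rw [Int.cast_natCast] at this
    rw [this]
    congr 1
    push_cast
    ring
  rw [h1, Complex.norm_exp_I_mul_ofReal_sub_one, Real.norm_eq_abs, abs_mul, abs_two]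
  congr 3
  ring

lemma std_geom (m : ℕ) [NeZero m] (h : ZMod m) (hh : h ≠ 0) (A L : ℕ) :
    ‖∑ n ∈ Finset.range L, ZMod.stdAddChar (h * ((A + n : ℕ) : ZMod m))‖ ≤ wgt m h := by
  set z : ℂ := ZMod.stdAddChar h with hz
  have hm : (0 : ℝ) < m := by exact_mod_cast Nat.pos_of_ne_zero (NeZero.ne m)
  have hv0 : 0 < h.val := Nat.pos_of_ne_zero (by rwa [Ne, ZMod.val_eq_zero])
  have hvm : h.val < m := ZMod.val_lt h
  have hv0' : (0 : ℝ) < h.val := by exact_mod_cast hv0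
  have hvm' : (h.val : ℝ) < m := by exact_mod_cast hvm
  have hsub : ((m - h.val : ℕ) : ℝ) = m - h.val := by rw [Nat.cast_sub hvm.le]
  -- sine lower bound
  have hsin : 0 < Real.sin (Real.pi * h.val / m) := by
    apply Real.sin_pos_of_pos_of_lt_pi
    · positivity
    · rw [div_lt_iff₀ hm]; exact mul_lt_mul_of_pos_left hvm' Real.pi_pos
  have hsinv : 1 / Real.sin (Real.pi * h.val / m) ≤ wgt m h := by
    have ha : (0 : ℝ) ≤ 1 / h.val := by positivity
    have hb : (0 : ℝ) ≤ 1 / ((m - h.val : ℕ) : ℝ) := by positivity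
    rcases le_total (2 * (h.val : ℝ)) m with hc | hc
    · have h1 : 2 * h.val / m ≤ Real.sin (Real.pi * h.val / m) := by
        have := Real.mul_le_sin (x := Real.pi * h.val / m) (by positivity) (by
          rw [div_le_div_iff₀ hm two_pos]; nlinarith [Real.pi_pos])
        refine le_trans (le_of_eq ?_) this
        have := Real.pi_pos.ne'
        field_simp
      refine (one_div_le_one_div_of_le (by positivity) h1).trans ?_
      unfold wgt
      calc 1 / (2 * (h.val : ℝ) / m) = m / 2 * (1 / h.val) := by field_simp
        _ ≤ _ := by gcongr; linarith
    · have h1 : 2 * (m - h.val) / m ≤ Real.sin (Real.pi * h.val / m) := by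
        rw [← Real.sin_pi_sub]
        have he : Real.pi - Real.pi * h.val / m = Real.pi * (m - h.val) / m := by field_simp
        rw [he]
        have := Real.mul_le_sin (x := Real.pi * (m - h.val) / m)
          (div_nonneg (mul_nonneg Real.pi_pos.le (by linarith)) hm.le) (by
          rw [div_le_div_iff₀ hm two_pos]; nlinarith [Real.pi_pos])
        refine le_trans (le_of_eq ?_) this
        have := Real.pi_pos.ne'
        field_simp
      have h2 : 0 < (m : ℝ) - h.val := by linarith
      refine (one_div_le_one_div_of_le (by positivity) h1).trans ?_
      unfold wgt
      rw [hsub] at hb ⊢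
      calc 1 / (2 * ((m : ℝ) - h.val) / m) = m / 2 * (1 / (m - h.val)) := by field_simp
        _ ≤ _ := by gcongr; linarith
  have hnorm : ‖z - 1‖ = 2 * Real.sin (Real.pi * h.val / m) := by
    rw [hz, std_norm_sub, abs_of_pos hsin]
  have hz1 : z ≠ 1 := by
    intro hcon
    rw [hcon, sub_self, norm_zero] at hnorm
    linarith
  have hsum : ∑ n ∈ Finset.range L, ZMod.stdAddChar (h * ((A + n : ℕ) : ZMod m)) =
      z ^ A * ((z ^ L - 1) / (z - 1)) := by
    rw [← geom_sum_eq hz1, Finset.mul_sum]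
    refine Finset.sum_congr rfl fun n _ => ?_
    rw [← pow_add, hz, ← AddChar.map_nsmul_eq_pow, nsmul_eq_mul, mul_comm]
  have hzn : ‖z‖ = 1 := AddChar.norm_apply _ _
  rw [hsum, norm_mul, norm_pow, hzn, one_pow, one_mul, norm_div, hnorm]
  refine le_trans ?_ hsinv
  have h2 : ‖z ^ L - 1‖ ≤ 2 := by
    refine (norm_sub_le _ _).trans ?_
    rw [norm_pow, hzn]; norm_num
  rw [div_le_div_iff₀ (by positivity) hsin]
  nlinarith

lemma harm_le (n : ℕ) (hn : 0 < n) (m : ℕ) (hnm : n ≤ m) :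
    ∑ v ∈ Finset.Icc 1 n, 1 / (v : ℝ) ≤ 1 + Real.log m := by
  have h1 := harmonic_le_one_add_log n
  rw [harmonic_eq_sum_Icc] at h1
  push_cast at h1
  simp only [one_div]
  refine h1.trans ?_
  have : Real.log n ≤ Real.log m :=
    Real.log_le_log (by exact_mod_cast hn) (by exact_mod_cast hnm)
  linarith

lemma gcd_sum (m : ℕ) (hm : 0 < m) :
    ∑ v ∈ Finset.Ico 1 m, (Nat.gcd v m : ℝ) / v ≤ m.divisors.card * (1 + Real.log m) := by
  have h1 : ∀ v ∈ Finset.Ico 1 m, (Nat.gcd v m : ℝ) / v ≤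
      ∑ d ∈ m.divisors, if d ∣ v then (d : ℝ) / v else 0 := by
    intro v hv
    have h := Finset.single_le_sum (f := fun d : ℕ => if d ∣ v then (d : ℝ) / v else 0)
      (s := m.divisors) (fun d _ => by split_ifs <;> positivity)
      (Nat.mem_divisors.2 ⟨Nat.gcd_dvd_right v m, hm.ne'⟩)
    simpa [Nat.gcd_dvd_left] using h
  refine (Finset.sum_le_sum h1).trans ?_
  rw [Finset.sum_comm, ← nsmul_eq_mul]
  refine Finset.sum_le_card_nsmul _ _ _ fun d hd => ?_
  obtain ⟨hdm, _⟩ := Nat.mem_divisors.1 hd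
  have hd0 : 0 < d := Nat.pos_of_dvd_of_pos hdm hm
  rw [← Finset.sum_filter]
  refine le_trans ?_ (harm_le (m / d) (Nat.div_pos (Nat.le_of_dvd hm hdm) hd0) m (Nat.div_le_self _ _))
  have hinj : Set.InjOn (fun v : ℕ => v / d) ↑((Finset.Ico 1 m).filter (fun v => d ∣ v)) := by
    intro a ha b hb hab
    simp only [Finset.coe_filter, Set.mem_ofPred_eq] at ha hb
    rw [← Nat.div_mul_cancel ha.2, ← Nat.div_mul_cancel hb.2]
    exact congrArg (· * d) hab
  have h2 : ∑ v ∈ (Finset.Ico 1 m).filter (fun v => d ∣ v), (d : ℝ) / v =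
      ∑ w ∈ ((Finset.Ico 1 m).filter (fun v => d ∣ v)).image (fun v => v / d), 1 / (w : ℝ) := by
    rw [Finset.sum_image hinj]
    refine Finset.sum_congr rfl fun v hv => ?_
    rw [Finset.mem_filter] at hv
    rw [Nat.cast_div hv.2 (by positivity), one_div_div]
  rw [h2]
  refine Finset.sum_le_sum_of_subset_of_nonneg ?_ (fun _ _ _ => by positivity)
  intro w hw
  obtain ⟨v, hv, rfl⟩ := Finset.mem_image.1 hw
  rw [Finset.mem_filter, Finset.mem_Ico] at hv
  rw [Finset.mem_Icc]
  exact ⟨Nat.div_pos (Nat.le_of_dvd hv.1.1 hv.2) hd0, Nat.div_le_div_right hv.1.2.le⟩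

/-- sum over nonzero residues -/
lemma sum_ne_zero_le (m : ℕ) [NeZero m] (f : ℕ → ℝ) (hf : ∀ v, 0 ≤ f v) :
    ∑ h ∈ Finset.univ.erase (0 : ZMod m), f h.val ≤ ∑ v ∈ Finset.Ico 1 m, f v := by
  rw [← Finset.sum_image (f := f) (g := fun h : ZMod m => h.val)
    (fun a _ b _ hab => ZMod.val_injective m hab)]
  refine Finset.sum_le_sum_of_subset_of_nonneg ?_ (fun _ _ _ => hf _)
  intro w hw
  obtain ⟨v, hv, rfl⟩ := Finset.mem_image.1 hw
  rw [Finset.mem_Ico]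
  refine ⟨Nat.pos_of_ne_zero ?_, ZMod.val_lt v⟩
  rw [Ne, ZMod.val_eq_zero]
  exact Finset.ne_of_mem_erase hv

lemma wgt_sum_gen (m : ℕ) [NeZero m] (c : ℕ → ℝ) (hc : ∀ v, 0 ≤ c v)
    (hsymm : ∀ v ∈ Finset.Ico 1 m, c (m - v) = c v) :
    ∑ h ∈ Finset.univ.erase (0 : ZMod m), wgt m h * c h.val ≤
      m * ∑ v ∈ Finset.Ico 1 m, c v / v := by
  have h1 := sum_ne_zero_le m
    (fun v => (m : ℝ) / 2 * (1 / (v : ℝ) + 1 / ((m - v : ℕ) : ℝ)) * c v)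
    (fun v => mul_nonneg (by positivity) (hc v))
  refine h1.trans (le_of_eq ?_)
  have h2 : ∑ v ∈ Finset.Ico 1 m, c v / ((m - v : ℕ) : ℝ) = ∑ v ∈ Finset.Ico 1 m, c v / (v : ℝ) := by
    refine Finset.sum_nbij' (fun v => m - v) (fun v => m - v) ?_ ?_ ?_ ?_ ?_
    · intro v hv; rw [Finset.mem_Ico] at *; omega
    · intro v hv; rw [Finset.mem_Ico] at *; omega
    · intro v hv; rw [Finset.mem_Ico] at *; omega
    · intro v hv; rw [Finset.mem_Ico] at *; omega
    · intro v hv; rw [hsymm v hv]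
  have h3 : ∀ v : ℕ, (m : ℝ) / 2 * (1 / (v : ℝ) + 1 / ((m - v : ℕ) : ℝ)) * c v =
      (m : ℝ) / 2 * (c v / (v : ℝ) + c v / ((m - v : ℕ) : ℝ)) := by intro v; ring
  simp only [h3]
  rw [← Finset.mul_sum, Finset.sum_add_distrib, h2]
  ring

lemma wgt_sum (m : ℕ) [NeZero m] :
    ∑ h ∈ Finset.univ.erase (0 : ZMod m), wgt m h ≤ m * (1 + Real.log m) := by
  have hm : 0 < m := Nat.pos_of_ne_zero (NeZero.ne m)
  have h := wgt_sum_gen m (fun _ => 1) (fun _ => zero_le_one) (fun _ _ => rfl)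
  simp only [mul_one] at h
  refine h.trans (mul_le_mul_of_nonneg_left ?_ (by positivity))
  refine le_trans ?_ (harm_le m hm m le_rfl)
  refine Finset.sum_le_sum_of_subset_of_nonneg ?_ (fun _ _ _ => by positivity)
  intro v hv; rw [Finset.mem_Ico] at hv; rw [Finset.mem_Icc]; omega

lemma wgt_gcd_sum (m : ℕ) [NeZero m] :
    ∑ h ∈ Finset.univ.erase (0 : ZMod m), wgt m h * (Nat.gcd h.val m : ℝ) ≤
      m * (m.divisors.card * (1 + Real.log m)) := by
  have hm : 0 < m := Nat.pos_of_ne_zero (NeZero.ne m)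
  have h := wgt_sum_gen m (fun v => (Nat.gcd v m : ℝ)) (fun _ => by positivity) (fun v hv => by
    rw [Finset.mem_Ico] at hv
    rw [Nat.gcd_self_sub_left hv.2.le, Nat.gcd_comm])
  exact h.trans (mul_le_mul_of_nonneg_left (gcd_sum m hm) (by positivity))

lemma annC_le (m : ℕ) [NeZero m] (a b : ZMod m) : annC a b ≤ Nat.gcd a.val m := by
  classical
  have hm : 0 < m := Nat.pos_of_ne_zero (NeZero.ne m)
  have h0 : 0 < Nat.gcd a.val m := Nat.gcd_pos_of_pos_right _ hm
  have h := IsAddCyclic.card_nsmul_eq_zero_le (α := ZMod m) h0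
  refine le_trans ?_ h
  unfold annC
  rw [Nat.card_eq_fintype_card, Fintype.card_subtype]
  refine Finset.card_le_card ?_
  intro t ht
  simp only [Finset.mem_filter, Finset.mem_univ, true_and] at ht ⊢
  rw [nsmul_eq_mul]
  have hb : ((Nat.gcd a.val m : ℕ) : ZMod m) = a * (Nat.gcdA a.val m : ℤ) := by
    have := congrArg (Int.cast : ℤ → ZMod m) (Nat.gcd_eq_gcd_ab a.val m)
    push_cast at this
    rw [this, ZMod.natCast_zmod_val, ZMod.natCast_self]
    ring
  rw [hb]
  linear_combination (Nat.gcdA a.val m : ZMod m) * ht.1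

end partE1

section partE2

lemma klR_zero (m : ℕ) [NeZero m] (ψ : AddChar (ZMod m) ℂ) : klR ψ 0 0 = m.totient := by
  unfold klR
  simp [ZMod.card_units_eq_totient]

lemma annC_neg {R : Type*} [CommRing R] (a b : R) : annC (-a) (-b) = annC a b := by
  unfold annC; simp

open Classical in
lemma ind_fourier (m : ℕ) [NeZero m] (x y : ZMod m) :
    ∑ h : ZMod m, ∑ k : ZMod m, ZMod.stdAddChar (h * x) * ZMod.stdAddChar (k * y) *
      klR ZMod.stdAddChar (-h) (-k) = if x * y = 1 then (m : ℂ) ^ 2 else 0 := by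
  set ψ : AddChar (ZMod m) ℂ := ZMod.stdAddChar with hψ
  have hprim : ψ.IsPrimitive := ZMod.isPrimitive_stdAddChar m
  have h1 : ∑ h : ZMod m, ∑ k : ZMod m, ψ (h * x) * ψ (k * y) * klR ψ (-h) (-k) =
      ∑ u : (ZMod m)ˣ, (∑ h : ZMod m, ψ (h * (x - u))) *
        (∑ k : ZMod m, ψ (k * (y - (u⁻¹ : (ZMod m)ˣ)))) := by
    unfold klR
    simp only [Finset.sum_mul_sum]
    conv_rhs => rw [Finset.sum_comm]
    refine Finset.sum_congr rfl fun h _ => ?_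
    conv_rhs => rw [Finset.sum_comm]
    refine Finset.sum_congr rfl fun k _ => ?_
    rw [Finset.mul_sum]
    refine Finset.sum_congr rfl fun u _ => ?_
    rw [← AddChar.map_add_eq_mul, ← AddChar.map_add_eq_mul, ← AddChar.map_add_eq_mul]
    congr 1
    ring
  rw [h1]
  simp only [AddChar.sum_mulShift _ hprim, ZMod.card, sub_eq_zero]
  split_ifs with hxy
  · rw [Finset.sum_eq_single (⟨x, y, hxy, by rw [mul_comm, hxy]⟩ : (ZMod m)ˣ)]
    · simp [sq]
    · intro u _ hu
      rw [if_neg, Nat.cast_zero, zero_mul]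
      intro hcon
      exact hu (Units.ext hcon.symm)
    · simp
  · refine Finset.sum_eq_zero fun u _ => ?_
    by_cases h2 : x = u
    · rw [if_neg (c := y = _), Nat.cast_zero, mul_zero]
      intro h3
      apply hxy
      rw [h2, h3, Units.mul_inv]
    · rw [if_neg h2, Nat.cast_zero, zero_mul]

open Classical in
lemma count_main (m : ℕ) [NeZero m] (A L B M : ℕ) (hM : M ≤ m) :
    |((((Finset.range L ×ˢ Finset.range M).filter (fun x : ℕ × ℕ =>
      ((A + x.1 : ℕ) : ZMod m) * ((B + x.2 : ℕ) : ZMod m) = 1)).card : ℕ) : ℝ) -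
      (L : ℝ) * M * m.totient / (m : ℝ) ^ 2| ≤
      2 * ((8 : ℝ) ^ m.primeFactors.card * (m.divisors.card * (1 + Real.log m)) * (1 + Real.log m)) *
        (m + L) / √(m : ℝ) := by
  have hm : 0 < m := Nat.pos_of_ne_zero (NeZero.ne m)
  have hm0 : (0 : ℝ) < m := by exact_mod_cast hm
  have hm1 : (1 : ℝ) ≤ m := by exact_mod_cast hm
  set ψ : AddChar (ZMod m) ℂ := ZMod.stdAddChar with hψ
  have hprim : ψ.IsPrimitive := ZMod.isPrimitive_stdAddChar m
  set N := ((Finset.range L ×ˢ Finset.range M).filter (fun x : ℕ × ℕ =>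
      ((A + x.1 : ℕ) : ZMod m) * ((B + x.2 : ℕ) : ZMod m) = 1)).card with hN
  set F : ZMod m → ℂ := fun h => ∑ n ∈ Finset.range L, ψ (h * ((A + n : ℕ) : ZMod m)) with hF
  set G : ZMod m → ℂ := fun h => ∑ n ∈ Finset.range M, ψ (h * ((B + n : ℕ) : ZMod m)) with hG
  set T := m.divisors.card * (1 + Real.log m) with hT
  set U := 1 + Real.log m with hU
  set W := (8 : ℝ) ^ m.primeFactors.card with hW
  have hU1 : 1 ≤ U := by rw [hU]; have := Real.log_nonneg hm1; linarith
  have hT0 : 0 ≤ T := by rw [hT]; positivity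
  have hW0 : 0 ≤ W := by positivity
  have hmain : (m : ℂ) ^ 2 * N = ∑ h : ZMod m, ∑ k : ZMod m, F h * G k * klR ψ (-h) (-k) := by
    have e1 : (m : ℂ) ^ 2 * N = ∑ x ∈ Finset.range L ×ˢ Finset.range M,
        if ((A + x.1 : ℕ) : ZMod m) * ((B + x.2 : ℕ) : ZMod m) = 1 then (m : ℂ) ^ 2 else 0 := by
      rw [← Finset.sum_filter, Finset.sum_const, nsmul_eq_mul, mul_comm]
    rw [e1]
    simp only [← ind_fourier]
    rw [Finset.sum_comm]
    refine Finset.sum_congr rfl fun h _ => ?_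
    rw [Finset.sum_comm]
    refine Finset.sum_congr rfl fun k _ => ?_
    rw [← Finset.sum_mul, hF, hG]
    dsimp only
    rw [Finset.sum_mul_sum, Finset.sum_product]
  have hF0 : F 0 = L := by simp [hF]
  have hG0 : G 0 = M := by simp [hG]
  have hFb : ∀ h ∈ Finset.univ.erase (0 : ZMod m), ‖F h‖ ≤ wgt m h := fun h hh =>
    std_geom m h (Finset.ne_of_mem_erase hh) A L
  have hGb : ∀ h ∈ Finset.univ.erase (0 : ZMod m), ‖G h‖ ≤ wgt m h := fun h hh =>
    std_geom m h (Finset.ne_of_mem_erase hh) B M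
  have hK : ∀ h k : ZMod m, ‖klR ψ (-h) (-k)‖ ≤ W * √(m : ℝ) * (Nat.gcd h.val m : ℝ) := by
    intro h k
    refine (klR_bound m ψ hprim _ _).trans ?_
    rw [annC_neg]
    have : (annC h k : ℝ) ≤ (Nat.gcd h.val m : ℝ) := by exact_mod_cast annC_le m h k
    gcongr
  have hK' : ∀ h k : ZMod m, ‖klR ψ (-h) (-k)‖ ≤ W * √(m : ℝ) * (Nat.gcd k.val m : ℝ) := by
    intro h k
    rw [klR_comm]
    exact hK k h
  -- split
  have hsplit : (m : ℂ) ^ 2 * N - (L : ℂ) * M * m.totient =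
      (∑ k ∈ Finset.univ.erase (0 : ZMod m), F 0 * G k * klR ψ (-0) (-k)) +
      ∑ h ∈ Finset.univ.erase (0 : ZMod m), (F h * G 0 * klR ψ (-h) (-0) +
        ∑ k ∈ Finset.univ.erase (0 : ZMod m), F h * G k * klR ψ (-h) (-k)) := by
    rw [hmain, ← Finset.add_sum_erase _ _ (Finset.mem_univ (0 : ZMod m)),
      ← Finset.add_sum_erase _ _ (Finset.mem_univ (0 : ZMod m))]
    have h3 : ∀ h : ZMod m, ∑ k : ZMod m, F h * G k * klR ψ (-h) (-k) =
        F h * G 0 * klR ψ (-h) (-0) +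
        ∑ k ∈ Finset.univ.erase (0 : ZMod m), F h * G k * klR ψ (-h) (-k) := fun h =>
      (Finset.add_sum_erase _ _ (Finset.mem_univ (0 : ZMod m))).symm
    simp only [h3]
    have h4 : klR ψ (-0) (-0) = m.totient := by rw [neg_zero, klR_zero]
    rw [h4, hF0, hG0]
    ring
  have hs0 : 0 ≤ √(m : ℝ) := Real.sqrt_nonneg _
  have hb1 : ‖∑ k ∈ Finset.univ.erase (0 : ZMod m), F 0 * G k * klR ψ (-0) (-k)‖ ≤
      L * (W * √(m : ℝ)) * (m * T) := by
    refine (norm_sum_le _ _).trans (le_trans (Finset.sum_le_sum (g := fun k => 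
      L * (W * √(m : ℝ)) * (wgt m k * (Nat.gcd k.val m : ℝ))) fun k hk => ?_) ?_)
    · rw [norm_mul, norm_mul, hF0, Complex.norm_natCast]
      have h1 := hGb k hk
      have h2 := hK' 0 k
      calc (L : ℝ) * ‖G k‖ * ‖klR ψ (-0) (-k)‖ ≤ L * wgt m k * (W * √(m : ℝ) * (Nat.gcd k.val m : ℝ)) := by
            have := wgt_nonneg m k
            gcongr
        _ = _ := by ring
    · rw [← Finset.mul_sum]
      exact mul_le_mul_of_nonneg_left (wgt_gcd_sum m) (by positivity)
  have hb2 : ‖∑ h ∈ Finset.univ.erase (0 : ZMod m), (F h * G 0 * klR ψ (-h) (-0) +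
        ∑ k ∈ Finset.univ.erase (0 : ZMod m), F h * G k * klR ψ (-h) (-k))‖ ≤
      (W * √(m : ℝ)) * (m + m * U) * (m * T) := by
    refine (norm_sum_le _ _).trans (le_trans (Finset.sum_le_sum (g := fun h => 
      (W * √(m : ℝ)) * (m + m * U) * (wgt m h * (Nat.gcd h.val m : ℝ))) fun h hh => ?_) ?_)
    · have h1 := hFb h hh
      have hw := wgt_nonneg m h
      have h2 : ‖F h * G 0 * klR ψ (-h) (-0)‖ ≤
          wgt m h * m * (W * √(m : ℝ) * (Nat.gcd h.val m : ℝ)) := by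
        rw [norm_mul, norm_mul, hG0, Complex.norm_natCast]
        have h3 := hK h 0
        have h4 : (M : ℝ) ≤ m := by exact_mod_cast hM
        gcongr
      have h5 : ‖∑ k ∈ Finset.univ.erase (0 : ZMod m), F h * G k * klR ψ (-h) (-k)‖ ≤
          wgt m h * (W * √(m : ℝ) * (Nat.gcd h.val m : ℝ)) * (m * U) := by
        refine (norm_sum_le _ _).trans (le_trans (Finset.sum_le_sum (g := fun k => 
          wgt m h * (W * √(m : ℝ) * (Nat.gcd h.val m : ℝ)) * wgt m k) fun k hk => ?_) ?_)
        · rw [norm_mul, norm_mul]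
          have h6 := hGb k hk
          have h7 := hK h k
          calc ‖F h‖ * ‖G k‖ * ‖klR ψ (-h) (-k)‖ ≤
                wgt m h * wgt m k * (W * √(m : ℝ) * (Nat.gcd h.val m : ℝ)) := by
                have := wgt_nonneg m k
                gcongr
            _ = _ := by ring
        · rw [← Finset.mul_sum]
          exact mul_le_mul_of_nonneg_left (wgt_sum m) (by positivity)
      refine (norm_add_le _ _).trans ((add_le_add h2 h5).trans (le_of_eq ?_))
      ring
    · rw [← Finset.mul_sum]
      exact mul_le_mul_of_nonneg_left (wgt_gcd_sum m) (by positivity)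
  have hfin : |(m : ℝ) ^ 2 * N - (L : ℝ) * M * m.totient| ≤
      L * (W * √(m : ℝ)) * (m * T) + (W * √(m : ℝ)) * (m + m * U) * (m * T) := by
    have : ((((m : ℝ) ^ 2 * N - (L : ℝ) * M * m.totient : ℝ)) : ℂ) =
      (m : ℂ) ^ 2 * N - (L : ℂ) * M * m.totient := by push_cast; ring
    rw [← Real.norm_eq_abs, ← Complex.norm_real, this, hsplit]
    exact (norm_add_le _ _).trans (add_le_add hb1 hb2)
  have hmul : (N : ℝ) - (L : ℝ) * M * m.totient / (m : ℝ) ^ 2 =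
      ((m : ℝ) ^ 2 * N - (L : ℝ) * M * m.totient) / (m : ℝ) ^ 2 := by field_simp
  have hsq : √(m : ℝ) * √(m : ℝ) = m := Real.mul_self_sqrt hm0.le
  have hsp : 0 < √(m : ℝ) := Real.sqrt_pos.2 hm0
  rw [hmul, abs_div, abs_of_pos (by positivity : (0 : ℝ) < (m : ℝ) ^ 2), div_le_div_iff₀ (by positivity) hsp]
  refine (mul_le_mul_of_nonneg_right hfin hs0).trans ?_
  have : (L * (W * √(m : ℝ)) * (m * T) + (W * √(m : ℝ)) * (m + m * U) * (m * T)) * √(m : ℝ) =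
      (W * T * (m : ℝ) ^ 2) * (L + (m + m * U)) := by
    linear_combination (L * W * m * T + W * (m + m * U) * m * T) * hsq
  rw [this]
  have h9 : 2 * (W * T * U) * (m + L) * (m : ℝ) ^ 2 = (W * T * (m : ℝ) ^ 2) * (2 * U * (m + L)) := by ring
  rw [h9]
  refine mul_le_mul_of_nonneg_left ?_ (by positivity)
  have hL0 : (0 : ℝ) ≤ L := by positivity
  nlinarith

end partE2

lemma modInv_spec (m : ℕ) [NeZero m] (q : ℕ) (hq : Nat.gcd q m = 1) :
    1 ≤ modInv m q ∧ modInv m q ≤ m ∧ (q : ZMod m) * (modInv m q : ZMod m) = 1 := by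
  have hm : 0 < m := Nat.pos_of_ne_zero (NeZero.ne m)
  have hinv : (q : ZMod m) * (q : ZMod m)⁻¹ = 1 := ZMod.coe_mul_inv_eq_one q hq
  unfold modInv
  split_ifs with h
  · refine ⟨hm, le_rfl, ?_⟩
    rw [ZMod.val_eq_zero] at h
    rw [ZMod.natCast_self, ← h]; exact hinv
  · refine ⟨Nat.pos_of_ne_zero h, (ZMod.val_lt _).le, ?_⟩
    rw [ZMod.natCast_zmod_val]; exact hinv

lemma modInv_uniq (m : ℕ) [NeZero m] (q B M i j : ℕ) (hM : M ≤ m) (hi : i < M) (hj : j < M)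
    (h1 : (q : ZMod m) * ((B + i : ℕ) : ZMod m) = 1) (h2 : (q : ZMod m) * ((B + j : ℕ) : ZMod m) = 1) :
    i = j := by
  have h3 : ((B + i : ℕ) : ZMod m) = ((B + j : ℕ) : ZMod m) := by
    linear_combination ((B + j : ℕ) : ZMod m) * h1 - ((B + i : ℕ) : ZMod m) * h2
  push_cast at h3
  have h4 : (i : ZMod m) = (j : ZMod m) := add_left_cancel h3
  rw [ZMod.natCast_eq_natCast_iff', Nat.mod_eq_of_lt (by omega), Nat.mod_eq_of_lt (by omega)] at h4
  exact h4

open Classical in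
lemma count_set (m : ℕ) [NeZero m] (A L B M : ℕ) (P : ℕ → Prop) (hB : 1 ≤ B) (hBM : B + M ≤ m + 1)
    (hP : ∀ y, 1 ≤ y → y ≤ m → (P y ↔ B ≤ y ∧ y < B + M)) (S : Set ℕ)
    (hS : ∀ q, q ∈ S ↔ (A ≤ q ∧ q < A + L) ∧ Nat.gcd q m = 1 ∧ P (modInv m q)) :
    S.ncard = ((Finset.range L ×ˢ Finset.range M).filter (fun x : ℕ × ℕ =>
      ((A + x.1 : ℕ) : ZMod m) * ((B + x.2 : ℕ) : ZMod m) = 1)).card := by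
  set Q := (Finset.range L ×ˢ Finset.range M).filter (fun x : ℕ × ℕ =>
      ((A + x.1 : ℕ) : ZMod m) * ((B + x.2 : ℕ) : ZMod m) = 1) with hQ
  have hinj : Set.InjOn (fun x : ℕ × ℕ => A + x.1) (Q : Set (ℕ × ℕ)) := by
    rintro ⟨a, b⟩ hab ⟨c, d⟩ hcd h
    rw [Finset.mem_coe, hQ, Finset.mem_filter, Finset.mem_product, Finset.mem_range, Finset.mem_range] at hab hcd
    have hac : a = c := by simpa using h
    subst hac
    have := modInv_uniq m (A + a) B M b d (by omega) hab.1.2 hcd.1.2 hab.2 hcd.2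
    rw [this]
  have hSQ : S = ((Q.image (fun x : ℕ × ℕ => A + x.1) : Finset ℕ) : Set ℕ) := by
    ext q
    rw [hS, Finset.mem_coe, Finset.mem_image]
    constructor
    · rintro ⟨⟨h1, h2⟩, hg, hp⟩
      obtain ⟨i1, i2, i3⟩ := modInv_spec m q hg
      obtain ⟨j1, j2⟩ := (hP _ i1 i2).1 hp
      refine ⟨(q - A, modInv m q - B), ?_, by simp; omega⟩
      rw [hQ, Finset.mem_filter, Finset.mem_product, Finset.mem_range, Finset.mem_range]
      dsimp only
      refine ⟨⟨by omega, by omega⟩, ?_⟩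
      rw [Nat.add_sub_cancel' h1, Nat.add_sub_cancel' j1]
      exact i3
    · rintro ⟨⟨a, b⟩, hab, rfl⟩
      rw [hQ, Finset.mem_filter, Finset.mem_product, Finset.mem_range, Finset.mem_range] at hab
      obtain ⟨⟨ha, hb⟩, he⟩ := hab
      dsimp only at ha hb he ⊢
      have hg : Nat.gcd (A + a) m = 1 := by
        have := (ZMod.isUnit_iff_coprime (A + a) m).1 (IsUnit.of_mul_eq_one _ he)
        exact this
      obtain ⟨i1, i2, i3⟩ := modInv_spec m (A + a) hg
      refine ⟨⟨by omega, by omega⟩, hg, ?_⟩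
      have := modInv_uniq m (A + a) 1 m (modInv m (A + a) - 1) (B + b - 1) le_rfl (by omega) (by omega)
        (by rw [Nat.add_sub_cancel' i1]; exact i3)
        (by rw [Nat.add_sub_cancel' (by omega)]; exact he)
      have h5 : modInv m (A + a) = B + b := by omega
      rw [h5, hP _ (by omega) (by omega)]
      omega
  rw [hSQ, Set.ncard_coe_finset, Finset.card_image_of_injOn hinj]

lemma final_est (ε C : ℝ) (hC : 1 ≤ C) (m : ℕ) [NeZero m]
    (hCm : (8 : ℝ) ^ m.primeFactors.card * (m.divisors.card * (1 + Real.log m)) * (1 + Real.log m)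
      ≤ C * (m : ℝ) ^ ε) (hε : 0 < ε)
    (α X : ℝ) (hα : 0 < α) (hα1 : α ≤ 1) (hX : 0 < X) (L M : ℕ) (N : ℝ)
    (hM : M ≤ m) (hL : |(L : ℝ) - X| ≤ 1) (hMa : |(M : ℝ) - α * m| ≤ 1)
    (hN : |N - (L : ℝ) * M * m.totient / (m : ℝ) ^ 2| ≤
      2 * ((8 : ℝ) ^ m.primeFactors.card * (m.divisors.card * (1 + Real.log m)) * (1 + Real.log m)) *
        (m + L) / √(m : ℝ)) :
    |N - α * ((m.totient : ℝ) / m) * X| ≤ 5 * C * (X + m) / (m : ℝ) ^ ((1 : ℝ) / 2 - ε) := by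
  have hm : 0 < m := Nat.pos_of_ne_zero (NeZero.ne m)
  have hm0 : (0 : ℝ) < m := by exact_mod_cast hm
  have hm1 : (1 : ℝ) ≤ m := by exact_mod_cast hm
  have hsp : 0 < √(m : ℝ) := Real.sqrt_pos.2 hm0
  have hsq : √(m : ℝ) * √(m : ℝ) = m := Real.mul_self_sqrt hm0.le
  have hs1 : 1 ≤ √(m : ℝ) := by rw [Real.one_le_sqrt]; exact hm1
  have hx1 : 1 ≤ (m : ℝ) ^ ε := Real.one_le_rpow hm1 hε.le
  have hrhs : 5 * C * (X + m) / (m : ℝ) ^ ((1 : ℝ) / 2 - ε) = 5 * (C * (m : ℝ) ^ ε) * (X + m) / √(m : ℝ) := by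
    rw [Real.rpow_sub hm0, ← Real.sqrt_eq_rpow]
    field_simp
  rw [hrhs]
  have hφ : (m.totient : ℝ) ≤ m := by exact_mod_cast Nat.totient_le m
  have hM' : (M : ℝ) ≤ m := by exact_mod_cast hM
  have h1 : |(L : ℝ) * M * m.totient / (m : ℝ) ^ 2 - α * ((m.totient : ℝ) / m) * X| ≤ (X + m) / √(m : ℝ) := by
    have e : (L : ℝ) * M * m.totient / (m : ℝ) ^ 2 - α * ((m.totient : ℝ) / m) * X =
        (((L : ℝ) - X) * M + X * (M - α * m)) * m.totient / (m : ℝ) ^ 2 := by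
      field_simp; ring
    rw [e, abs_div, abs_mul, abs_of_pos (by positivity : (0 : ℝ) < (m : ℝ) ^ 2),
      abs_of_nonneg (by positivity : (0 : ℝ) ≤ m.totient)]
    have h2 : |((L : ℝ) - X) * M + X * (M - α * m)| ≤ X + m := by
      refine (abs_add_le _ _).trans ?_
      rw [abs_mul, abs_mul, abs_of_pos hX, abs_of_nonneg (by positivity : (0 : ℝ) ≤ M)]
      nlinarith [abs_nonneg ((L : ℝ) - X), abs_nonneg ((M : ℝ) - α * m), (by positivity : (0 : ℝ) ≤ M)]
    calc _ ≤ (X + m) * m / (m : ℝ) ^ 2 := by gcongr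
      _ = (X + m) / m := by field_simp
      _ ≤ _ := by
        apply div_le_div_of_nonneg_left (by linarith) hsp
        nlinarith
  have h3 : |N - (L : ℝ) * M * m.totient / (m : ℝ) ^ 2| ≤ 4 * (C * (m : ℝ) ^ ε) * (X + m) / √(m : ℝ) := by
    refine hN.trans ?_
    apply div_le_div_of_nonneg_right _ hsp.le
    have hL2 : (m : ℝ) + L ≤ 2 * (X + m) := by
      have := (abs_le.1 hL).2
      linarith
    calc _ ≤ 2 * (C * (m : ℝ) ^ ε) * (2 * (X + m)) := by gcongr
      _ = _ := by ring
  have h4 : (X + m) / √(m : ℝ) ≤ (C * (m : ℝ) ^ ε) * (X + m) / √(m : ℝ) := by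
    apply div_le_div_of_nonneg_right _ hsp.le
    have : 1 ≤ C * (m : ℝ) ^ ε := by nlinarith
    nlinarith
  have h5 := abs_sub_le N ((L : ℝ) * M * m.totient / (m : ℝ) ^ 2) (α * ((m.totient : ℝ) / m) * X)
  calc _ ≤ _ := h5
    _ ≤ 4 * (C * (m : ℝ) ^ ε) * (X + m) / √(m : ℝ) + (C * (m : ℝ) ^ ε) * (X + m) / √(m : ℝ) :=
      add_le_add h3 (h1.trans h4)
    _ = _ := by ring

/-- **Lemma 2.1.** Distribution of modular inverses: for any `ε > 0` there is `C(ε) > 0`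
such that for all positive integers `p`, all `α ∈ (0,1]` and all reals `X₂ > X₁ ≥ 0`, both
`#{X₁ ≤ q ≤ X₂ : gcd(q,p) = 1, inv_p(q) ≤ αp}` and
`#{X₁ ≤ q ≤ X₂ : gcd(q,p) = 1, inv_p(q) > (1-α)p}` equal
`α(φ(p)/p)(X₂ - X₁) + O_ε((X₂ - X₁ + p)/p^{1/2-ε})`. -/
theorem modular_inverse_distribution :
    ∀ ε : ℝ, 0 < ε → ∃ C : ℝ, 0 < C ∧
      ∀ p : ℕ, 0 < p → ∀ α : ℝ, 0 < α → α ≤ 1 →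
        ∀ X₁ X₂ : ℝ, 0 ≤ X₁ → X₁ < X₂ →
      |({q : ℕ | X₁ ≤ (q : ℝ) ∧ (q : ℝ) ≤ X₂ ∧ Nat.gcd q p = 1 ∧
            (modInv p q : ℝ) ≤ α * p}.ncard : ℝ)
          - α * ((p.totient : ℝ) / p) * (X₂ - X₁)|
        ≤ C * (X₂ - X₁ + p) / (p : ℝ) ^ ((1:ℝ)/2 - ε) ∧
      |({q : ℕ | X₁ ≤ (q : ℝ) ∧ (q : ℝ) ≤ X₂ ∧ Nat.gcd q p = 1 ∧
            (1 - α) * p < (modInv p q : ℝ)}.ncard : ℝ)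
          - α * ((p.totient : ℝ) / p) * (X₂ - X₁)|
        ≤ C * (X₂ - X₁ + p) / (p : ℝ) ^ ((1:ℝ)/2 - ε) := by
  intro ε hε
  obtain ⟨C, hC, hall⟩ := all_const ε hε
  refine ⟨5 * C, by linarith, fun p hp α hα hα1 X₁ X₂ hX₁ hX => ?_⟩
  have : NeZero p := ⟨hp.ne'⟩
  have hp0 : (0 : ℝ) < p := by exact_mod_cast hp
  have hX₂ : 0 ≤ X₂ := hX₁.trans hX.le
  have hle : ⌈X₁⌉₊ ≤ ⌊X₂⌋₊ + 1 :=
    (Nat.ceil_le_floor_add_one X₁).trans (Nat.succ_le_succ (Nat.floor_le_floor hX.le))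
  have hmem : ∀ q : ℕ, (X₁ ≤ q ∧ (q : ℝ) ≤ X₂) ↔
      (⌈X₁⌉₊ ≤ q ∧ q < ⌈X₁⌉₊ + (⌊X₂⌋₊ + 1 - ⌈X₁⌉₊)) := by
    intro q
    rw [Nat.add_sub_cancel' hle, Nat.ceil_le, Nat.lt_succ_iff, Nat.le_floor_iff hX₂]
  have hL : |((⌊X₂⌋₊ + 1 - ⌈X₁⌉₊ : ℕ) : ℝ) - (X₂ - X₁)| ≤ 1 := by
    rw [Nat.cast_sub hle, abs_le]
    push_cast
    have h1 := Nat.floor_le hX₂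
    have h2 := Nat.lt_floor_add_one X₂
    have h3 := Nat.le_ceil X₁
    have h4 := Nat.ceil_lt_add_one hX₁
    constructor <;> linarith
  have hap : 0 ≤ α * p := by positivity
  have hap' : 0 ≤ (1 - α) * p := mul_nonneg (by linarith) hp0.le
  constructor
  · have hM : ⌊α * p⌋₊ ≤ p := by
      apply Nat.floor_le_of_le
      nlinarith
    refine final_est ε C hC p (hall p hp) hε α _ hα hα1 (by linarith) (⌊X₂⌋₊ + 1 - ⌈X₁⌉₊) ⌊α * p⌋₊ _ hM hL ?_ ?_
    · rw [abs_le]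
      have h1 := Nat.floor_le hap
      have h2 := Nat.lt_floor_add_one (α * p)
      constructor <;> linarith
    · rw [count_set p ⌈X₁⌉₊ (⌊X₂⌋₊ + 1 - ⌈X₁⌉₊) 1 ⌊α * p⌋₊ (fun y => (y : ℝ) ≤ α * p) le_rfl (by omega)
        (fun y h1 h2 => by rw [← Nat.le_floor_iff hap]; omega) _
        (fun q => by rw [← hmem]; simp only [Set.mem_ofPred_eq]; tauto)]
      exact count_main p _ _ _ _ hM
  · have hM : ⌊(1 - α) * p⌋₊ ≤ p := by
      apply Nat.floor_le_of_le
      nlinarith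
    refine final_est ε C hC p (hall p hp) hε α _ hα hα1 (by linarith) (⌊X₂⌋₊ + 1 - ⌈X₁⌉₊)
      (p - ⌊(1 - α) * p⌋₊) _ (Nat.sub_le _ _) hL ?_ ?_
    · rw [Nat.cast_sub hM, abs_le]
      have h1 := Nat.floor_le hap'
      have h2 := Nat.lt_floor_add_one ((1 - α) * p)
      constructor <;> linarith
    · rw [count_set p ⌈X₁⌉₊ (⌊X₂⌋₊ + 1 - ⌈X₁⌉₊) (⌊(1 - α) * p⌋₊ + 1) (p - ⌊(1 - α) * p⌋₊)
        (fun y => (1 - α) * p < (y : ℝ)) (by omega) (by omega)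
        (fun y h1 h2 => by rw [← Nat.floor_lt hap']; omega) _
        (fun q => by rw [← hmem]; simp only [Set.mem_ofPred_eq]; tauto)]
      exact count_main p _ _ _ _ (Nat.sub_le _ _)
end

section
/- Let p, q ≥ 2 be coprime integers and let α = v/w be a reduced rational number in (0,1] with w ≤ p or w ≤ q. Then inv_p(q) ≤ α·p if and only if inv_q(p) > (1−α)·q. -/
lemma modInv_spec_s10 (p q : ℕ) (hp : 2 ≤ p) (hpq : Nat.Coprime p q) :
    0 < modInv p q ∧ modInv p q < p ∧ (p : ℤ) ∣ (q : ℤ) * modInv p q - 1 := by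
  have : NeZero p := ⟨by omega⟩
  have : Fact (1 < p) := ⟨by omega⟩
  have h1 : (q : ZMod p) * (q : ZMod p)⁻¹ = 1 := ZMod.coe_mul_inv_eq_one q hpq.symm
  have h0 : ((q : ZMod p)⁻¹).val ≠ 0 := by
    intro h
    rw [ZMod.val_eq_zero] at h
    rw [h, mul_zero] at h1
    exact zero_ne_one h1
  have hm : modInv p q = ((q : ZMod p)⁻¹).val := by simp only [modInv, if_neg h0]
  rw [hm]
  refine ⟨Nat.pos_of_ne_zero h0, ZMod.val_lt _, ?_⟩
  rw [← ZMod.intCast_zmod_eq_zero_iff_dvd] 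
  push_cast
  rw [ZMod.natCast_zmod_val, h1, sub_self]

/-- **Lemma 2.2 (inversion trick).** For coprime integers `p, q ≥ 2` and a reduced rational
`α = v/w ∈ (0,1]` with `w ≤ p` or `w ≤ q`, one has `inv_p(q) ≤ αp ↔ inv_q(p) > (1-α)q`. -/
theorem modular_inversion_trick (p q : ℕ) (hp : 2 ≤ p) (hq : 2 ≤ q)
    (hpq : Nat.Coprime p q) (α : ℚ) (hα0 : 0 < α) (hα1 : α ≤ 1)
    (hw : α.den ≤ p ∨ α.den ≤ q) :
    (modInv p q : ℚ) ≤ α * p ↔ (1 - α) * q < (modInv q p : ℚ) := by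
  obtain ⟨x0, xp, hx⟩ := modInv_spec_s10 p q hp hpq
  obtain ⟨y0, yq, hy⟩ := modInv_spec_s10 q p hq hpq.symm
  generalize modInv p q = x at *
  generalize modInv q p = y at *
  have key : (q : ℤ) * x + p * y = p * q + 1 := by
    have hd : (p : ℤ) * q ∣ q * x + p * y - 1 := by
      apply IsCoprime.mul_dvd (Nat.isCoprime_iff_coprime.mpr hpq)
      · have := dvd_add hx (Dvd.intro (y : ℤ) rfl : (p : ℤ) ∣ p * y)
        convert this using 1; ring
      · have := dvd_add hy (Dvd.intro (x : ℤ) rfl : (q : ℤ) ∣ q * x)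
        convert this using 1; ring
    obtain ⟨c, hc⟩ := hd
    zify at *
    have hpq0 : (0 : ℤ) < p * q := by positivity
    have c0 : 0 < c := by
      by_contra h
      nlinarith
    have c2 : c < 2 := by
      by_contra h
      nlinarith
    have : c = 1 := by omega
    subst this
    linarith
  have hwpos : (0 : ℤ) < α.den := by exact_mod_cast α.den_pos
  have hwq : (0 : ℚ) < α.den := by exact_mod_cast α.den_pos
  have hα : α * α.den = α.num := Rat.mul_den_eq_num α
  have e1 : (x : ℚ) ≤ α * p ↔ (α.den : ℤ) * x ≤ α.num * p := by
    rw [← mul_le_mul_iff_right₀ hwq, ← mul_assoc, mul_comm (α.den : ℚ) α, hα]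
    exact_mod_cast Iff.rfl
  have e2 : (1 - α) * q < (y : ℚ) ↔ ((α.den : ℤ) - α.num) * q < α.den * y := by
    rw [← mul_lt_mul_iff_right₀ hwq, ← mul_assoc, mul_sub, mul_one, mul_comm (α.den : ℚ) α, hα]
    exact_mod_cast Iff.rfl
  rw [e1, e2]
  zify at hw hp hq
  generalize (α.den : ℤ) = w at *
  generalize α.num = v at *
  have key2 : (p : ℤ) * (w * y - (w - v) * q) + q * (w * x - v * p) = w := by
    linear_combination w * key
  constructor
  · intro h
    by_contra h2
    nlinarith
  · intro h
    by_contra h2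
    have ht : 1 ≤ w * (y : ℤ) - (w - v) * q := by omega
    have hk : 1 ≤ w * (x : ℤ) - v * p := by omega
    have := mul_le_mul_of_nonneg_left ht (by omega : (0 : ℤ) ≤ p)
    have := mul_le_mul_of_nonneg_left hk (by omega : (0 : ℤ) ≤ q)
    omega
end

section
/- Let α = v/w be a reduced rational number in (0,1]. For a positive integer q set δ_α(q) = #{ p ∈ ℕ : (1−α)q < p ≤ q, gcd(p,q) = 1 } and κ_α(q) = Σ_{1 ≤ r < w} (1 − {α r}) · Σ_{d ∣ q, d ≡ r (mod w)} μ(q/d), where {x} is the fractional part and μ is the Möbius function. Then δ_α(q) = α·φ(q) + κ_α(q) for every integer q ≥ 1, where φ is Euler's totient function. -/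
/-- `κ_α(q) = ∑_{1 ≤ r < w} (1 - {α r}) ∑_{d ∣ q, d ≡ r (mod w)} μ(q/d)` for a reduced
rational `α = v/w`. -/
def kappa (α : ℚ) (q : ℕ) : ℚ :=
  ∑ r ∈ Finset.Ico 1 α.den, (1 - Int.fract (α * r)) *
    ∑ d ∈ q.divisors.filter (fun d => d % α.den = r), (ArithmeticFunction.moebius (q / d) : ℚ)

/-- `δ_α(q) = #{p ∈ ℕ : (1-α)q < p ≤ q, gcd(p,q) = 1}`. -/
def deltaCount (α : ℚ) (q : ℕ) : ℕ :=
  ((Finset.Icc 1 q).filter (fun p : ℕ => (1 - α) * q < (p : ℚ) ∧ Nat.gcd p q = 1)).card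

theorem aux_mu (n : ℕ) :
    ∑ e ∈ n.divisors, (ArithmeticFunction.moebius e : ℚ) = if n = 1 then 1 else 0 := by
  have h := congrArg (fun f : ArithmeticFunction ℤ => f n) ArithmeticFunction.coe_zeta_mul_moebius
  simp only [ArithmeticFunction.coe_zeta_mul_apply, ArithmeticFunction.one_apply] at h
  exact_mod_cast h

theorem aux_count (α : ℚ) (hα1 : α ≤ 1) (hα0 : 0 < α) (e d : ℕ) (he : 0 < e) :
    ((((Finset.Icc 1 (e * d)).filter
      (fun p : ℕ => (1 - α) * (e * d : ℕ) < (p : ℚ) ∧ e ∣ p)).card : ℕ) : ℚ) = (⌈α * d⌉ : ℤ) := by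
  have hnn : 0 ≤ (1 - α) * (d : ℚ) := mul_nonneg (by linarith) (by positivity)
  have he' : (0 : ℚ) < e := by exact_mod_cast he
  have hset : (Finset.Icc 1 (e * d)).filter
      (fun p : ℕ => (1 - α) * (e * d : ℕ) < (p : ℚ) ∧ e ∣ p)
      = (Finset.Ioc ⌊(1 - α) * (d : ℚ)⌋₊ d).image (fun m => e * m) := by
    ext p
    simp only [Finset.mem_filter, Finset.mem_Icc, Finset.mem_image, Finset.mem_Ioc]
    constructor
    · rintro ⟨⟨h1, h2⟩, h3, m, rfl⟩
      refine ⟨m, ⟨?_, Nat.le_of_mul_le_mul_left h2 he⟩, rfl⟩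
      rw [Nat.floor_lt hnn]
      push_cast at h3
      nlinarith
    · rintro ⟨m, ⟨h1, h2⟩, rfl⟩
      have hm : 0 < m := by omega
      rw [Nat.floor_lt hnn] at h1
      refine ⟨⟨Nat.mul_pos he hm, Nat.mul_le_mul_left _ h2⟩, ?_, dvd_mul_right _ _⟩
      push_cast
      nlinarith
  rw [hset, Finset.card_image_of_injective _ (fun a b h => Nat.eq_of_mul_eq_mul_left he h),
    Nat.card_Ioc]
  have hle : ⌊(1 - α) * (d : ℚ)⌋₊ ≤ d := by
    apply Nat.floor_le_of_le
    have : (0:ℚ) ≤ d := by positivity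
    nlinarith
  have hk : ((⌊(1 - α) * (d : ℚ)⌋₊ : ℕ) : ℤ) = (d : ℤ) - ⌈α * d⌉ := by
    rw [Int.natCast_floor_eq_floor hnn]
    have : (1 - α) * (d : ℚ) = (-(α * d)) + (d : ℤ) := by push_cast; ring
    rw [this, Int.floor_add_intCast, Int.floor_neg]
    ring
  have : ((d - ⌊(1 - α) * (d : ℚ)⌋₊ : ℕ) : ℤ) = ⌈α * d⌉ := by
    rw [Nat.cast_sub hle, hk]; ring
  exact_mod_cast this

theorem aux_delta (α : ℚ) (hα0 : 0 < α) (hα1 : α ≤ 1) (q : ℕ) (hq : 1 ≤ q) :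
    (deltaCount α q : ℚ)
      = ∑ d ∈ q.divisors, (ArithmeticFunction.moebius (q / d) : ℚ) * (⌈α * d⌉ : ℤ) := by
  have h1 : (deltaCount α q : ℚ) = ∑ p ∈ Finset.Icc 1 q, ∑ e ∈ q.divisors,
      if (1 - α) * q < (p : ℚ) ∧ e ∣ p then (ArithmeticFunction.moebius e : ℚ) else 0 := by
    unfold deltaCount
    rw [Finset.card_filter, Nat.cast_sum]
    refine Finset.sum_congr rfl fun p hp => ?_
    by_cases hc : (1 - α) * q < (p : ℚ)
    · simp only [hc, true_and]
      rw [← Finset.sum_filter]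
      have : q.divisors.filter (fun e => e ∣ p) = (Nat.gcd p q).divisors := by
        ext e
        simp only [Finset.mem_filter, Nat.mem_divisors, Nat.dvd_gcd_iff]
        have : q ≠ 0 := by omega
        have hg : Nat.gcd p q ≠ 0 := (Nat.gcd_pos_of_pos_right _ hq).ne'
        tauto
      rw [this, aux_mu]
      push_cast
      rfl
    · simp [hc]
  rw [h1, Finset.sum_comm, ← Nat.sum_div_divisors]
  refine Finset.sum_congr rfl fun e he => ?_
  obtain ⟨d, rfl⟩ := (Nat.mem_divisors.1 he).1
  have he0 : 0 < e := Nat.pos_of_mul_pos_right hq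
  have hd0 : 0 < d := Nat.pos_of_mul_pos_left hq
  rw [Nat.mul_div_cancel_left _ he0, ← aux_count α hα1 hα0 d e hd0, mul_comm d e,
    ← Finset.sum_filter, Finset.sum_const, nsmul_eq_mul, mul_comm]

theorem aux_totient (q : ℕ) (hq : 1 ≤ q) :
    (q.totient : ℚ) = ∑ d ∈ q.divisors, (ArithmeticFunction.moebius (q / d) : ℚ) * d := by
  have h := aux_delta 1 one_pos le_rfl q hq
  simp only [one_mul, Int.ceil_natCast, Int.cast_natCast] at h
  rw [← h]
  congr 1
  unfold deltaCount
  rw [← Nat.filter_coprime_Ico_eq_totient q 1]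
  congr 1
  ext p
  simp only [Finset.mem_filter, Finset.mem_Icc, Finset.mem_Ico, sub_self, zero_mul, Nat.cast_pos,
    Nat.coprime_iff_gcd_eq_one, Nat.gcd_comm q p]
  constructor
  · rintro ⟨⟨h1, h2⟩, h3⟩
    exact ⟨⟨h1, by omega⟩, by omega, h3⟩
  · rintro ⟨⟨h1, h2⟩, _, h3⟩
    exact ⟨⟨h1, by omega⟩, h3⟩

theorem aux_kappa (α : ℚ) (q : ℕ) :
    kappa α q = ∑ d ∈ q.divisors, (ArithmeticFunction.moebius (q / d) : ℚ) *
      ((⌈α * d⌉ : ℤ) - α * d) := by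
  unfold kappa
  simp only [Finset.sum_filter, Finset.mul_sum]
  rw [Finset.sum_comm]
  refine Finset.sum_congr rfl fun d _ => ?_
  simp only [mul_ite, mul_zero]
  rw [Finset.sum_ite_eq]
  have hw : (α.den : ℚ) ≠ 0 := by exact_mod_cast α.den_nz
  have hdec : α * d = α * (d % α.den : ℕ) + ((α.num * (d / α.den : ℕ) : ℤ) : ℚ) := by
    have h1 : (d : ℚ) = (d % α.den : ℕ) + α.den * (d / α.den : ℕ) := by
      exact_mod_cast (Nat.mod_add_div d α.den).symm
    have h2 : α * α.den = α.num := Rat.mul_den_eq_num α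
    rw [Int.cast_mul, Int.cast_natCast, ← h2]
    calc α * d = α * ((d % α.den : ℕ) + α.den * (d / α.den : ℕ)) := by rw [← h1]
      _ = _ := by ring
  have hfr : Int.fract (α * d) = Int.fract (α * (d % α.den : ℕ)) := by
    rw [hdec, Int.fract_add_intCast]
  by_cases h0 : d % α.den = 0
  · rw [if_neg (by simp [h0]), hdec, h0]
    simp only [Nat.cast_zero, mul_zero, zero_add, Int.ceil_intCast, sub_self]
  · have hlt : d % α.den < α.den := Nat.mod_lt _ α.den_pos
    rw [if_pos (by rw [Finset.mem_Ico]; omega), ← hfr]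
    have hne : Int.fract (α * d) ≠ 0 := by
      intro hz
      obtain ⟨z, hz⟩ := Int.fract_eq_zero_iff.1 hz
      apply h0
      have h2 : α * α.den = α.num := Rat.mul_den_eq_num α
      have h3 : α.num * d = z * α.den := by
        have : (α.num : ℚ) * d = z * α.den := by rw [← h2, hz]; ring
        exact_mod_cast this
      have h4 : α.den ∣ α.num.natAbs * d := by
        rw [← Int.natCast_dvd_natCast]
        push_cast
        rw [← dvd_abs, abs_mul, abs_abs, ← abs_mul, dvd_abs, h3]
        exact dvd_mul_left _ _
      exact Nat.mod_eq_zero_of_dvd ((α.reduced.symm).dvd_of_dvd_mul_left h4)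
    rw [Int.ceil_sub_self_eq hne]
    ring

/-- **Lemma 2.3.** For a reduced rational `α = v/w ∈ (0,1]` and every integer `q ≥ 1`,
`δ_α(q) = α·φ(q) + κ_α(q)`. -/
theorem delta_eq_totient_add_kappa (α : ℚ) (hα0 : 0 < α) (hα1 : α ≤ 1)
    (q : ℕ) (hq : 1 ≤ q) :
    (deltaCount α q : ℚ) = α * q.totient + kappa α q := by
  rw [aux_delta α hα0 hα1 q hq, aux_totient q hq, aux_kappa, Finset.mul_sum,
    ← Finset.sum_add_distrib]
  refine Finset.sum_congr rfl fun d _ => ?_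
  ring
end

section
/- Let α = v/w be a reduced rational number in (0,1] and for a positive integer q set κ_α(q) = Σ_{1 ≤ r < w} (1 − {α r}) · Σ_{d ∣ q, d ≡ r (mod w)} μ(q/d). Then there is a constant C(α) > 0 such that for every real x > w, | Σ_{q < x} κ_α(q)/q² − Σ_{1 ≤ r < w} (1 − {α r})·ζ(2, r/w)/(w² ζ(2)) | ≤ C(α)·(log x)/x, where ζ(s,x) = Σ_{n ≥ 0} (n+x)^{−s} is the Hurwitz zeta function and ζ the Riemann zeta function. -/
/-- The Hurwitz zeta value `ζ(2,x) = ∑_{n ≥ 0} (n+x)^{-2}`. -/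
noncomputable def hzeta2 (x : ℝ) : ℝ := ∑' n : ℕ, 1 / ((n : ℝ) + x) ^ 2

/-- The quantity `F(α) = (1/(α w²)) ∑_{1 ≤ r < w} (1 - {α r}) ζ(2, r/w)` for a reduced
rational `α = v/w`. -/
noncomputable def Fcal (α : ℚ) : ℝ :=
  (1 / ((α : ℝ) * (α.den : ℝ) ^ 2)) *
    ∑ r ∈ Finset.Ico 1 α.den, (1 - Int.fract ((α : ℝ) * r)) * hzeta2 ((r : ℝ) / (α.den : ℝ))

open Finset in
lemma ks_tail (a : ℕ → ℝ) (ha : ∀ d, |a d| ≤ ((d : ℝ) ^ 2)⁻¹) (S : ℝ) (hS : HasSum a S) (D : ℕ) :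
    |(∑ d ∈ Finset.Ioc 0 D, a d) - S| ≤ 2 / ((D : ℝ) + 1) := by
  have h0 : a 0 = 0 := by
    have := ha 0
    simpa using this
  have ht := hS.tendsto_sum_nat
  have ht2 : Filter.Tendsto (fun n => |(∑ d ∈ Finset.Ioc 0 D, a d) - ∑ i ∈ Finset.range n, a i|)
      Filter.atTop (nhds |(∑ d ∈ Finset.Ioc 0 D, a d) - S|) :=
    (tendsto_const_nhds.sub ht).abs
  refine le_of_tendsto ht2 ?_
  filter_upwards [Filter.eventually_gt_atTop D] with n hn
  have h1 : ∑ i ∈ Finset.range n, a i = ∑ d ∈ Finset.Ioc 0 D, a d + ∑ d ∈ Finset.Ioo D n, a d := by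
    rw [← Finset.sum_union]
    · symm
      apply Finset.sum_subset
      · intro k; simp; omega
      · intro k hk hk2
        simp at hk hk2
        have : k = 0 := by
          by_contra h
          have := hk2.1 (Nat.pos_of_ne_zero h)
          have := hk2.2
          omega
        rw [this, h0]
    · rw [Finset.disjoint_left]
      intro k; simp; omega
  rw [h1, sub_add_cancel_left, abs_neg]
  calc |∑ d ∈ Finset.Ioo D n, a d| ≤ ∑ d ∈ Finset.Ioo D n, |a d| := Finset.abs_sum_le_sum_abs _ _
    _ ≤ ∑ d ∈ Finset.Ioo D n, ((d : ℝ) ^ 2)⁻¹ := Finset.sum_le_sum fun i _ => ha i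
    _ ≤ _ := sum_Ioo_inv_sq_le D n

lemma ks_moebius_bound (m : ℕ) :
    |(ArithmeticFunction.moebius m : ℝ) / (m : ℝ) ^ 2| ≤ ((m : ℝ) ^ 2)⁻¹ := by
  rw [abs_div, abs_of_nonneg (by positivity : (0 : ℝ) ≤ (m : ℝ) ^ 2), div_eq_mul_inv]
  have : |(ArithmeticFunction.moebius m : ℝ)| ≤ 1 := by
    exact_mod_cast ArithmeticFunction.abs_moebius_le_one
  exact mul_le_of_le_one_left (by positivity) this

lemma ks_moebius_sum :
    HasSum (fun m : ℕ => (ArithmeticFunction.moebius m : ℝ) / (m : ℝ) ^ 2) (Real.pi ^ 2 / 6)⁻¹ := by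
  have h2 : (1 : ℝ) < (2 : ℂ).re := by norm_num
  have hs := ArithmeticFunction.LSeriesSummable_moebius_iff.mpr h2
  have hm := ArithmeticFunction.LSeries_zeta_mul_Lseries_moebius h2
  rw [ArithmeticFunction.LSeries_zeta_eq_riemannZeta h2, riemannZeta_two] at hm
  have h3 := hs.LSeriesHasSum
  have h4 := eq_inv_of_mul_eq_one_right hm
  rw [h4] at h3
  unfold LSeriesHasSum at h3
  have h5 := Complex.hasSum_re h3
  convert! h5 using 1
  · funext m
    rcases eq_or_ne m 0 with rfl | hm0
    · simp
    · rw [LSeries.term_of_ne_zero hm0]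
      have : (((ArithmeticFunction.moebius m : ℤ) : ℂ) / (m : ℂ) ^ (2 : ℂ))
          = (((ArithmeticFunction.moebius m : ℝ) / (m : ℝ) ^ 2 : ℝ) : ℂ) := by
        push_cast
        congr 1
        exact_mod_cast Complex.cpow_natCast (m : ℂ) 2
      rw [this, Complex.ofReal_re]
  · have : ((Real.pi : ℂ) ^ 2 / 6)⁻¹ = (((Real.pi ^ 2 / 6)⁻¹ : ℝ) : ℂ) := by push_cast; rfl
    rw [this, Complex.ofReal_re]

lemma ks_hzeta (w r : ℕ) (hr : 1 ≤ r) (hrw : r < w) :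
    HasSum (fun d : ℕ => (if d % w = r then (1 : ℝ) else 0) / (d : ℝ) ^ 2)
      (hzeta2 ((r : ℝ) / w) / (w : ℝ) ^ 2) := by
  have hw : (0 : ℝ) < w := by exact_mod_cast (by omega : 0 < w)
  set a : ℕ → ℝ := fun d : ℕ => (if d % w = r then (1 : ℝ) else 0) / (d : ℝ) ^ 2 with ha
  have hsum : Summable a := by
    refine Summable.of_nonneg_of_le (f := fun d : ℕ => ((d : ℝ) ^ 2)⁻¹) ?_ ?_ ?_
    · intro d; simp only [ha]; split_ifs <;> positivity
    · intro d; simp only [ha]; split_ifs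
      · simp
      · simp
    · exact Real.summable_nat_pow_inv.mpr (by norm_num)
  have hinj : Function.Injective (fun n : ℕ => w * n + r) := by
    intro m n h
    have : w * m = w * n := by simpa using h
    exact Nat.eq_of_mul_eq_mul_left (by omega) this
  have hcomp : ∀ n : ℕ, a (w * n + r) = 1 / ((n : ℝ) + r / w) ^ 2 / (w : ℝ) ^ 2 := by
    intro n
    have : (w * n + r) % w = r := by
      rw [Nat.mul_add_mod, Nat.mod_eq_of_lt hrw]
    simp only [ha, this, if_true]
    push_cast
    rw [div_div, ← mul_pow]
    congr 2
    field_simp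
  have htsum : ∑' d, a d = hzeta2 ((r : ℝ) / w) / (w : ℝ) ^ 2 := by
    rw [hzeta2, ← tsum_div_const, ← hinj.tsum_eq]
    · exact tsum_congr hcomp
    · intro d hd
      have hd' : d % w = r := by
        by_contra h
        apply hd
        simp [ha, h]
      exact ⟨d / w, by simp only; rw [← hd']; exact Nat.div_add_mod d w⟩
  rw [← htsum]
  exact hsum.hasSum

lemma ks_swap (f : ℕ → ℝ) (N : ℕ) :
    ∑ q ∈ Finset.Ioc 0 N,
      (∑ d ∈ q.divisors, f d * (ArithmeticFunction.moebius (q / d) : ℝ)) / (q : ℝ) ^ 2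
    = ∑ m ∈ Finset.Ioc 0 N, (ArithmeticFunction.moebius m : ℝ) / (m : ℝ) ^ 2 *
        ∑ d ∈ Finset.Ioc 0 (N / m), f d / (d : ℝ) ^ 2 := by
  let F : ArithmeticFunction ℝ := ⟨fun m => (ArithmeticFunction.moebius m : ℝ) / (m : ℝ) ^ 2, by simp⟩
  let G : ArithmeticFunction ℝ := ⟨fun d => f d / (d : ℝ) ^ 2, by simp⟩
  have := ArithmeticFunction.sum_Ioc_mul_eq_sum_sum F G N
  refine Eq.trans ?_ this
  refine Finset.sum_congr rfl fun q hq => ?_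
  have hq0 : 0 < q := (Finset.mem_Ioc.mp hq).1
  rw [ArithmeticFunction.mul_apply, Nat.sum_divisorsAntidiagonal' (fun x y => F x * G y),
    Finset.sum_div]
  refine Finset.sum_congr rfl fun d hd => ?_
  have hdq := Nat.dvd_of_mem_divisors hd
  obtain ⟨k, rfl⟩ := hdq
  have hd0 : 0 < d := Nat.pos_of_mul_pos_right hq0
  have hk0 : 0 < k := Nat.pos_of_mul_pos_left hq0
  rw [Nat.mul_div_cancel_left _ hd0]
  change _ = (ArithmeticFunction.moebius k : ℝ) / (k : ℝ) ^ 2 * (f d / (d : ℝ) ^ 2)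
  push_cast
  field_simp

lemma ks_main (w r : ℕ) (hr : 1 ≤ r) (hrw : r < w) (N : ℕ) (hN : 1 ≤ N) :
    |(∑ q ∈ Finset.Ioc 0 N,
      (∑ d ∈ q.divisors, (if d % w = r then (1 : ℝ) else 0) *
        (ArithmeticFunction.moebius (q / d) : ℝ)) / (q : ℝ) ^ 2)
      - hzeta2 ((r : ℝ) / w) / (w : ℝ) ^ 2 * (Real.pi ^ 2 / 6)⁻¹|
    ≤ (6 + 2 * Real.log N) / N := by
  rw [ks_swap]
  set f : ℕ → ℝ := fun d => if d % w = r then (1 : ℝ) else 0 with hf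
  set G := hzeta2 ((r : ℝ) / w) / (w : ℝ) ^ 2 with hG
  set M := (Real.pi ^ 2 / 6)⁻¹ with hM
  have hNpos : (0 : ℝ) < N := by exact_mod_cast hN
  have hfb : ∀ d : ℕ, |f d / (d : ℝ) ^ 2| ≤ ((d : ℝ) ^ 2)⁻¹ := by
    intro d
    simp only [hf]
    split_ifs
    · rw [abs_of_nonneg (by positivity)]; simp
    · simp
  have hT := ks_tail (fun d => f d / (d : ℝ) ^ 2) hfb G (ks_hzeta w r hr hrw)
  have hMt := ks_tail _ ks_moebius_bound M ks_moebius_sum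
  have hGb : |G| ≤ 2 := by
    have := hT 0
    simpa using this
  have hsplit : (∑ m ∈ Finset.Ioc 0 N, (ArithmeticFunction.moebius m : ℝ) / (m : ℝ) ^ 2 *
        ∑ d ∈ Finset.Ioc 0 (N / m), f d / (d : ℝ) ^ 2) - G * M
      = (∑ m ∈ Finset.Ioc 0 N, (ArithmeticFunction.moebius m : ℝ) / (m : ℝ) ^ 2 *
        ((∑ d ∈ Finset.Ioc 0 (N / m), f d / (d : ℝ) ^ 2) - G))
        + G * ((∑ m ∈ Finset.Ioc 0 N, (ArithmeticFunction.moebius m : ℝ) / (m : ℝ) ^ 2) - M) := by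
    simp only [mul_sub, Finset.sum_sub_distrib, ← Finset.sum_mul]
    ring
  rw [hsplit]
  have h1 : |∑ m ∈ Finset.Ioc 0 N, (ArithmeticFunction.moebius m : ℝ) / (m : ℝ) ^ 2 *
        ((∑ d ∈ Finset.Ioc 0 (N / m), f d / (d : ℝ) ^ 2) - G)| ≤ 2 / N * (1 + Real.log N) := by
    refine (Finset.abs_sum_le_sum_abs _ _).trans ?_
    have hh := harmonic_le_one_add_log N
    rw [harmonic_eq_sum_Icc] at hh
    push_cast at hh
    refine le_trans ?_ (mul_le_mul_of_nonneg_left hh (by positivity))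
    rw [Finset.mul_sum]
    refine Finset.sum_le_sum (fun m hm => ?_)
    have hm0 : 0 < m := (Finset.mem_Ioc.mp hm).1
    have hm' : (0 : ℝ) < m := by exact_mod_cast hm0
    rw [abs_mul]
    have hlt : (N : ℝ) ≤ m * (((N / m : ℕ) : ℝ) + 1) := by
      exact_mod_cast (Nat.lt_mul_div_succ N hm0).le
    calc _ ≤ ((m : ℝ) ^ 2)⁻¹ * (2 / (((N / m : ℕ) : ℝ) + 1)) :=
          mul_le_mul (ks_moebius_bound m) (hT _) (abs_nonneg _) (by positivity)
      _ ≤ ((m : ℝ) ^ 2)⁻¹ * (2 * m / N) := by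
          refine mul_le_mul_of_nonneg_left ?_ (by positivity)
          rw [div_le_div_iff₀ (by positivity) hNpos]
          nlinarith
      _ = _ := by field_simp
  have h2 : |G * ((∑ m ∈ Finset.Ioc 0 N, (ArithmeticFunction.moebius m : ℝ) / (m : ℝ) ^ 2) - M)|
      ≤ 2 * (2 / N) := by
    rw [abs_mul]
    refine mul_le_mul hGb ((hMt N).trans ?_) (abs_nonneg _) (by norm_num)
    gcongr
    linarith
  refine (abs_add_le _ _).trans ((add_le_add h1 h2).trans (le_of_eq ?_))
  field_simp
  ring

/-- **Lemma 2.7, last formula.** For a reduced rational `α = v/w ∈ (0,1]` and real `x > w`: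
`∑_{q < x} κ_α(q)/q² = ∑_{1 ≤ r < w} (1 - {αr}) ζ(2,r/w)/(w²ζ(2)) + O_α((log x)/x)`. -/
theorem kappa_sum_asymptotic (α : ℚ) (hα0 : 0 < α) (hα1 : α ≤ 1) :
    ∃ C : ℝ, 0 < C ∧ ∀ x : ℝ, (α.den : ℝ) < x →
      |(∑ q ∈ Finset.Ico 1 ⌈x⌉₊, (kappa α q : ℝ) / (q : ℝ)^2)
        - ∑ r ∈ Finset.Ico 1 α.den,
            (1 - Int.fract ((α : ℝ) * r)) * hzeta2 ((r : ℝ) / (α.den : ℝ)) /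
              ((α.den : ℝ)^2 * (Real.pi^2/6))|
      ≤ C * Real.log x / x := by
  have hw : 1 ≤ α.den := α.den_pos
  refine ⟨28 * α.den, by positivity, ?_⟩
  intro x hx
  have hw1 : (1 : ℝ) ≤ α.den := by exact_mod_cast hw
  rcases hw.eq_or_lt with h1 | h2
  · have hk : ∀ q, kappa α q = 0 := by
      intro q
      simp [kappa, ← h1]
    simp only [hk, ← h1]
    have : 0 ≤ Real.log x := Real.log_nonneg (by linarith)
    have : 0 < x := by linarith
    simp
    positivity
  have hx2 : 2 < x := by
    have : (2 : ℝ) ≤ α.den := by exact_mod_cast h2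
    linarith
  obtain ⟨N, hN⟩ : ∃ N, ⌈x⌉₊ = N + 1 :=
    Nat.exists_eq_succ_of_ne_zero (Nat.ceil_pos.mpr (by linarith)).ne'
  have hNx : (N : ℝ) < x := by
    apply Nat.lt_ceil.mp
    omega
  have hxN : x ≤ N + 1 := by
    have := Nat.le_ceil x
    rw [hN] at this
    exact_mod_cast this
  have hN1 : (1 : ℝ) < N := by linarith
  have hN1' : 1 ≤ N := by
    have : 1 < N := by exact_mod_cast hN1
    omega
  have hIco : Finset.Ico 1 ⌈x⌉₊ = Finset.Ioc 0 N := by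
    ext k; simp [hN]; omega
  rw [hIco]
  have hlog : 1 / 2 ≤ Real.log x := by
    have := Real.log_two_gt_d9
    have := Real.log_le_log (by norm_num) hx2.le
    linarith
  have hlogN : Real.log N ≤ Real.log x := Real.log_le_log (by linarith) hNx.le
  have hbound : (6 + 2 * Real.log N) / N ≤ 28 * Real.log x / x := by
    rw [div_le_div_iff₀ (by linarith) (by linarith)]
    have : 6 + 2 * Real.log N ≤ 14 * Real.log x := by linarith
    have hxx : x ≤ 2 * N := by linarith
    calc (6 + 2 * Real.log N) * x ≤ (14 * Real.log x) * (2 * N) := by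
          gcongr
      _ = _ := by ring
  have hkap : ∀ q : ℕ, (kappa α q : ℝ) = ∑ r ∈ Finset.Ico 1 α.den, (1 - Int.fract ((α : ℝ) * r)) *
      ∑ d ∈ q.divisors, (if d % α.den = r then (1 : ℝ) else 0) *
        (ArithmeticFunction.moebius (q / d) : ℝ) := by
    intro q
    unfold kappa
    push_cast
    refine Finset.sum_congr rfl fun r _ => ?_
    congr 1
    rw [Finset.sum_filter]
    refine Finset.sum_congr rfl fun d _ => ?_
    split_ifs <;> simp
  have hrew : (∑ q ∈ Finset.Ioc 0 N, (kappa α q : ℝ) / (q : ℝ)^2)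
        - ∑ r ∈ Finset.Ico 1 α.den,
            (1 - Int.fract ((α : ℝ) * r)) * hzeta2 ((r : ℝ) / (α.den : ℝ)) /
              ((α.den : ℝ)^2 * (Real.pi^2/6))
      = ∑ r ∈ Finset.Ico 1 α.den, (1 - Int.fract ((α : ℝ) * r)) *
        ((∑ q ∈ Finset.Ioc 0 N,
      (∑ d ∈ q.divisors, (if d % α.den = r then (1 : ℝ) else 0) *
        (ArithmeticFunction.moebius (q / d) : ℝ)) / (q : ℝ) ^ 2)
      - hzeta2 ((r : ℝ) / α.den) / (α.den : ℝ) ^ 2 * (Real.pi ^ 2 / 6)⁻¹) := by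
    simp only [hkap, Finset.sum_div]
    rw [Finset.sum_comm, ← Finset.sum_sub_distrib]
    refine Finset.sum_congr rfl fun r _ => ?_
    rw [mul_sub, Finset.mul_sum]
    congr 1
    · refine Finset.sum_congr rfl fun q _ => ?_
      rw [← Finset.sum_div, mul_div_assoc]
    · field_simp
  rw [hrew]
  refine (Finset.abs_sum_le_sum_abs _ _).trans ?_
  have hterm : ∀ r ∈ Finset.Ico 1 α.den, |(1 - Int.fract ((α : ℝ) * r)) *
        ((∑ q ∈ Finset.Ioc 0 N,
      (∑ d ∈ q.divisors, (if d % α.den = r then (1 : ℝ) else 0) *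
        (ArithmeticFunction.moebius (q / d) : ℝ)) / (q : ℝ) ^ 2)
      - hzeta2 ((r : ℝ) / α.den) / (α.den : ℝ) ^ 2 * (Real.pi ^ 2 / 6)⁻¹)|
      ≤ 28 * Real.log x / x := by
    intro r hr
    rw [Finset.mem_Ico] at hr
    rw [abs_mul]
    have hc : |1 - Int.fract ((α : ℝ) * r)| ≤ 1 := by
      rw [abs_le]
      constructor <;> linarith [Int.fract_nonneg ((α : ℝ) * r), Int.fract_lt_one ((α : ℝ) * r)]
    exact (mul_le_of_le_one_left (abs_nonneg _) hc).trans
      ((ks_main α.den r hr.1 hr.2 N hN1').trans hbound)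
  refine (Finset.sum_le_card_nsmul _ _ _ hterm).trans ?_
  rw [Nat.card_Ico, nsmul_eq_mul]
  have hcard : ((α.den - 1 : ℕ) : ℝ) ≤ α.den := by exact_mod_cast Nat.sub_le _ _
  have hpos : 0 ≤ 28 * Real.log x / x := by
    apply div_nonneg <;> linarith
  calc _ ≤ (α.den : ℝ) * (28 * Real.log x / x) := mul_le_mul_of_nonneg_right hcard hpos
    _ = _ := by ring
end
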